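/- arXiv:1802.09056 — 4 statements merged into one kernel-verified Lean document; each statement's English description precedes it below -/
import Mathlib

section
/- Let λ₁,…,λₙ be distinct points in the open unit disc 𝔻 and let W₁,…,Wₙ be 2×2 complex matrices, Wₖ = [w_{ij}ᵏ], with w₁₂ᵏ w₂₁ᵏ ≠ 0 for k = 1,…,n. Then the following are equivalent: (1) there exists an analytic function F : 𝔻 → ℂ^{2×2} such that F(λₖ) = Wₖ for k = 1,…,n and μ_Diag(F(λ)) ≤ 1 for every λ ∈ 𝔻; (2) there exist complex numbers b₁,…,bₙ and c₁,…,cₙ with bₖcₖ = w₁₁ᵏ w₂₂ᵏ − det Wₖ for k = 1,…,n such that the 2n×2n block matrix whose (k,ℓ) block (of size 2×2) is (I − Vₖ* V_ℓ)/(1 − conj(λₖ)λ_ℓ), where Vₖ = [[w₁₁ᵏ, bₖ],[cₖ, w₂₂ᵏ]], is positive semidefinite. -/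
open scoped Matrix ComplexOrder

/-- The operator norm of a 2×2 complex matrix with respect to the Euclidean norm on ℂ². -/
noncomputable def opNorm2 (A : Matrix (Fin 2) (Fin 2) ℂ) : ℝ :=
  ‖Matrix.toEuclideanCLM (𝕜 := ℂ) A‖

open scoped Classical in
/-- The structured singular value of a 2×2 matrix relative to the diagonal matrices. -/
noncomputable def muDiag (A : Matrix (Fin 2) (Fin 2) ℂ) : ℝ :=
  if ∀ X : Matrix (Fin 2) (Fin 2) ℂ, X.IsDiag → (1 - A * X).det ≠ 0 then 0
  else
    (sInf {r : ℝ | ∃ X : Matrix (Fin 2) (Fin 2) ℂ,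
        X.IsDiag ∧ (1 - A * X).det = 0 ∧ r = opNorm2 X})⁻¹

/-- `muDiag A ≤ 1` iff every diagonal `X` making `1 - A * X` singular has norm at least one. -/
lemma muDiag_le_one_iff (A : Matrix (Fin 2) (Fin 2) ℂ) :
    muDiag A ≤ 1 ↔
      ∀ X : Matrix (Fin 2) (Fin 2) ℂ, X.IsDiag → (1 - A * X).det = 0 → 1 ≤ opNorm2 X := by
  unfold muDiag
  split_ifs with h
  · simp only [zero_le_one, true_iff]
    exact fun X hX h0 => absurd h0 (h X hX)
  push Not at h
  obtain ⟨X₀, hX₀, hdet₀⟩ := h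
  set S : Set ℝ := {r : ℝ | ∃ X : Matrix (Fin 2) (Fin 2) ℂ,
        X.IsDiag ∧ (1 - A * X).det = 0 ∧ r = opNorm2 X} with hS
  have hne : S.Nonempty := ⟨_, X₀, hX₀, hdet₀, rfl⟩
  have hlow : ∀ r ∈ S, (opNorm2 A + 1)⁻¹ ≤ r := by
    rintro r ⟨X, -, hdet, rfl⟩
    obtain ⟨v, hv, hv0⟩ := Matrix.exists_mulVec_eq_zero_iff.mpr hdet
    have hv' : v = A *ᵥ (X *ᵥ v) := by
      rw [Matrix.sub_mulVec, Matrix.one_mulVec, sub_eq_zero] at hv0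
      rw [Matrix.mulVec_mulVec]; exact hv0
    have hpos : 0 < ‖WithLp.toLp 2 v‖ := by
      rw [norm_pos_iff]; simpa using hv
    have h1 : ‖WithLp.toLp 2 v‖ ≤ opNorm2 A * (opNorm2 X * ‖WithLp.toLp 2 v‖) := by
      conv_lhs => rw [hv']
      rw [← Matrix.toEuclideanCLM_toLp, ← Matrix.toEuclideanCLM_toLp]
      refine (ContinuousLinearMap.le_opNorm _ _).trans ?_
      exact mul_le_mul_of_nonneg_left (ContinuousLinearMap.le_opNorm _ _) (norm_nonneg _)
    have hA : 0 ≤ opNorm2 A := norm_nonneg _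
    have hX : 0 ≤ opNorm2 X := norm_nonneg _
    rw [inv_le_iff_one_le_mul₀ (by positivity)]
    have : 1 ≤ opNorm2 A * opNorm2 X := by
      rw [← mul_assoc] at h1
      exact (le_mul_iff_one_le_left hpos).mp h1
    nlinarith
  have hbdd : BddBelow S := ⟨_, hlow⟩
  have hpos : 0 < sInf S :=
    lt_of_lt_of_le (inv_pos.mpr (by have : 0 ≤ opNorm2 A := norm_nonneg _; linarith))
      (le_csInf hne hlow)
  rw [inv_le_one₀ hpos, le_csInf_iff hbdd hne]
  constructor
  · exact fun h X hX h0 => h _ ⟨X, hX, h0, rfl⟩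
  · rintro h r ⟨X, hX, h0, rfl⟩
    exact h X hX h0

/-- A diagonal matrix with entries in the open unit disc is a strict contraction. -/
lemma opNorm2_diagonal_lt_one {x y : ℂ} (hx : ‖x‖ < 1) (hy : ‖y‖ < 1) :
    opNorm2 (Matrix.diagonal ![x, y]) < 1 := by
  have h : opNorm2 (Matrix.diagonal ![x, y]) = ‖(![x, y] : Fin 2 → ℂ)‖ :=
    Matrix.l2_opNorm_diagonal (𝕜 := ℂ) ![x, y]
  rw [h, pi_norm_lt_iff one_pos]
  intro i
  fin_cases i <;> simpa

/-- A polynomial of degree one in each variable that has no zeros in the open bidisc satisfies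
the tetrablock inequality. -/
lemma tetrablock_inequality (a d e : ℂ)
    (h : ∀ x y : ℂ, ‖x‖ < 1 → ‖y‖ < 1 → 1 - a * x - d * y + e * (x * y) ≠ 0) :
    ‖a‖ ≤ 1 ∧ 2 * ‖d - (starRingEnd ℂ) a * e‖ ≤ 1 + ‖d‖ ^ 2 - ‖a‖ ^ 2 - ‖e‖ ^ 2 := by
  have hball : ∀ y : ℂ, ‖y‖ < 1 → ‖a - e * y‖ ≤ ‖1 - d * y‖ := by
    intro y hy
    by_contra! hlt
    have hne : a - e * y ≠ 0 := by
      rw [← norm_pos_iff]; exact (norm_nonneg _).trans_lt hlt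
    refine h ((1 - d * y) / (a - e * y)) y ?_ hy ?_
    · rw [norm_div, div_lt_one (norm_pos_iff.mpr hne)]; exact hlt
    · rw [show a * ((1 - d * y) / (a - e * y)) = a * (1 - d * y) / (a - e * y) by ring,
        show e * ((1 - d * y) / (a - e * y) * y) = e * y * (1 - d * y) / (a - e * y) by ring]
      have : a * (1 - d * y) / (a - e * y) - e * y * (1 - d * y) / (a - e * y) = 1 - d * y := by
        rw [← sub_div, div_eq_iff hne]; ring
      linear_combination -this
  have hclosed : ∀ y : ℂ, ‖y‖ ≤ 1 → ‖a - e * y‖ ≤ ‖1 - d * y‖ := by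
    intro y hy
    have hcl : IsClosed {y : ℂ | ‖a - e * y‖ ≤ ‖1 - d * y‖} :=
      isClosed_le (by fun_prop) (by fun_prop)
    have hsub : Metric.ball (0 : ℂ) 1 ⊆ {y : ℂ | ‖a - e * y‖ ≤ ‖1 - d * y‖} :=
      fun z hz => hball z (by simpa using hz)
    have := hcl.closure_subset_iff.mpr hsub
    rw [closure_ball _ one_ne_zero] at this
    exact this (by simpa using hy)
  refine ⟨by simpa using hball 0 (by simp), ?_⟩
  set u := d - (starRingEnd ℂ) a * e with hu
  obtain ⟨y, hy, hyu⟩ : ∃ y : ℂ, ‖y‖ = 1 ∧ y * u = ‖u‖ := by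
    by_cases h0 : u = 0
    · exact ⟨1, by simp, by simp [h0]⟩
    · have hn : (‖u‖ : ℂ) ≠ 0 := by simpa using h0
      refine ⟨(starRingEnd ℂ) u / ‖u‖, by simp [h0], ?_⟩
      rw [div_mul_eq_mul_div, Complex.conj_mul', pow_two, mul_div_cancel_right₀ _ hn]
  have h1 := pow_le_pow_left₀ (norm_nonneg _) (hclosed y hy.le) 2
  have h2 : ‖y‖ ^ 2 = 1 := by rw [hy]; norm_num
  have h3 := congrArg Complex.re hyu
  rw [Complex.ofReal_re] at h3
  rw [← h3, hu]
  simp only [Complex.sq_norm, Complex.normSq_apply, Complex.sub_re, Complex.sub_im,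
    Complex.mul_re, Complex.mul_im, Complex.one_re, Complex.one_im, Complex.conj_re,
    Complex.conj_im] at h1 h2 ⊢
  have key : (1 - (d.re * y.re - d.im * y.im)) * (1 - (d.re * y.re - d.im * y.im)) +
      (0 - (d.re * y.im + d.im * y.re)) * (0 - (d.re * y.im + d.im * y.re)) =
      1 + (d.re * d.re + d.im * d.im) - 2 * (d.re * y.re - d.im * y.im) := by
    linear_combination (d.re * d.re + d.im * d.im) * h2
  have key2 : (a.re - (e.re * y.re - e.im * y.im)) * (a.re - (e.re * y.re - e.im * y.im)) +
      (a.im - (e.re * y.im + e.im * y.re)) * (a.im - (e.re * y.im + e.im * y.re)) =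
      a.re * a.re + a.im * a.im + (e.re * e.re + e.im * e.im)
      - 2 * (a.re * (e.re * y.re - e.im * y.im) + a.im * (e.re * y.im + e.im * y.re)) := by
    linear_combination (e.re * e.re + e.im * e.im) * h2
  rw [key, key2] at h1
  linarith

/-- The determinant form of the tetrablock inequality. -/
lemma tetrablock_det_inequality (a d e : ℂ)
    (h : ∀ x y : ℂ, ‖x‖ < 1 → ‖y‖ < 1 → 1 - a * x - d * y + e * (x * y) ≠ 0) :
    ‖e‖ ≤ 1 ∧ 2 * ‖a * d - e‖ ≤ 1 - ‖a‖ ^ 2 - ‖d‖ ^ 2 + ‖e‖ ^ 2 := by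
  obtain ⟨ha, h1⟩ := tetrablock_inequality a d e h
  obtain ⟨hd, h2⟩ := tetrablock_inequality d a e (fun x y hx hy => by
    have := h y x hy hx
    rwa [show 1 - d * x - a * y + e * (x * y) = 1 - a * y - d * x + e * (y * x) by ring])
  have hS := norm_nonneg (d - (starRingEnd ℂ) a * e)
  have hS' := norm_nonneg (a - (starRingEnd ℂ) d * e)
  have hE : ‖e‖ ≤ 1 := by
    have := norm_nonneg e
    nlinarith
  have hid : ‖d - (starRingEnd ℂ) a * e‖ ^ 2 - ‖a * d - e‖ ^ 2 =
      (‖d‖ ^ 2 - ‖e‖ ^ 2) * (1 - ‖a‖ ^ 2) := by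
    simp only [Complex.sq_norm, Complex.normSq_apply, Complex.sub_re, Complex.sub_im,
      Complex.mul_re, Complex.mul_im, Complex.conj_re, Complex.conj_im]
    ring
  refine ⟨hE, ?_⟩
  have hT := norm_nonneg (a * d - e)
  have htri : ‖a‖ * ‖d‖ - ‖e‖ ≤ ‖a * d - e‖ := by
    rw [← norm_mul]; exact norm_sub_norm_le _ _
  have hA := norm_nonneg a
  have hD := norm_nonneg d
  have hE0 := norm_nonneg e
  generalize ‖a‖ = A at *
  generalize ‖d‖ = D at *
  generalize ‖e‖ = E at *
  generalize ‖a * d - e‖ = T at *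
  generalize ‖d - (starRingEnd ℂ) a * e‖ = S at *
  have hsq : (2 * T) ^ 2 ≤ (1 - A ^ 2 - D ^ 2 + E ^ 2) ^ 2 := by
    have : (2 * S) ^ 2 ≤ (1 + D ^ 2 - A ^ 2 - E ^ 2) ^ 2 :=
      pow_le_pow_left₀ (by positivity) h1 2
    nlinarith
  rcases le_or_gt 0 (1 - A ^ 2 - D ^ 2 + E ^ 2) with hq | hq
  · exact (pow_le_pow_iff_left₀ (by positivity) hq two_ne_zero).mp hsq
  exfalso
  have h3 : 2 * T ≤ A ^ 2 + D ^ 2 - 1 - E ^ 2 := by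
    refine (pow_le_pow_iff_left₀ (by positivity) (by linarith) two_ne_zero).mp ?_
    linarith
  have h4 : A ^ 2 + D ^ 2 - 1 ≤ (A * D) ^ 2 := by
    have : 0 ≤ (1 - A ^ 2) * (1 - D ^ 2) :=
      mul_nonneg (by nlinarith) (by nlinarith)
    nlinarith
  have hAD : A * D ≤ 1 := mul_le_one₀ ha hD hd
  have h5 : E < A * D := by
    refine lt_of_pow_lt_pow_left₀ 2 (by positivity) ?_
    linarith
  nlinarith

/-- A `2 × 2` matrix with off-diagonal entries of equal modulus is a contraction as soon as the
tetrablock polynomial has no zeros in the open bidisc. -/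
lemma contraction_of_tetrablock (a b c d : ℂ) (hbc : ‖b‖ = ‖c‖)
    (h : ∀ x y : ℂ, ‖x‖ < 1 → ‖y‖ < 1 → 1 - a * x - d * y + (a * d - b * c) * (x * y) ≠ 0)
    (x y : ℂ) : ‖a * x + b * y‖ ^ 2 + ‖c * x + d * y‖ ^ 2 ≤ ‖x‖ ^ 2 + ‖y‖ ^ 2 := by
  obtain ⟨hE, hdet⟩ := tetrablock_det_inequality a d (a * d - b * c) h
  rw [sub_sub_cancel, norm_mul, hbc] at hdet
  have hE0 := norm_nonneg (a * d - b * c)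
  set p := 1 - ‖a‖ ^ 2 - ‖c‖ ^ 2 with hp
  set q := 1 - ‖b‖ ^ 2 - ‖d‖ ^ 2 with hq
  set g := (starRingEnd ℂ) a * b + (starRingEnd ℂ) c * d with hg
  have hE2 : ‖a * d - b * c‖ ^ 2 ≤ 1 := by nlinarith
  have hsum : 0 ≤ p + q := by rw [hp, hq, hbc]; nlinarith
  have hprod : ‖g‖ ^ 2 ≤ p * q := by
    have hid : p * q - ‖g‖ ^ 2 =
        1 - ‖a‖ ^ 2 - ‖b‖ ^ 2 - ‖c‖ ^ 2 - ‖d‖ ^ 2 + ‖a * d - b * c‖ ^ 2 := by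
      simp only [hp, hq, hg, Complex.sq_norm, Complex.normSq_apply, Complex.sub_re,
        Complex.sub_im, Complex.add_re, Complex.add_im, Complex.mul_re, Complex.mul_im,
        Complex.conj_re, Complex.conj_im]
      ring
    rw [hbc] at hid
    nlinarith
  have hid : ‖x‖ ^ 2 + ‖y‖ ^ 2 - (‖a * x + b * y‖ ^ 2 + ‖c * x + d * y‖ ^ 2) =
      p * ‖x‖ ^ 2 + q * ‖y‖ ^ 2 - 2 * ((starRingEnd ℂ) x * g * y).re := by
    simp only [hp, hq, hg, Complex.sq_norm, Complex.normSq_apply, Complex.add_re,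
      Complex.add_im, Complex.mul_re, Complex.mul_im, Complex.conj_re, Complex.conj_im]
    ring
  have hre : ((starRingEnd ℂ) x * g * y).re ≤ ‖x‖ * ‖g‖ * ‖y‖ := by
    refine (Complex.re_le_norm _).trans ?_
    rw [norm_mul, norm_mul, Complex.norm_conj]
  have hpq : 0 ≤ p * q := (sq_nonneg _).trans hprod
  have hp0 : 0 ≤ p := by
    by_contra! hneg
    nlinarith
  have hq0 : 0 ≤ q := by
    by_contra! hneg
    nlinarith
  have hgle : ‖g‖ ≤ √p * √q := by
    rw [← Real.sqrt_mul hp0]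
    exact Real.le_sqrt_of_sq_le hprod
  have h1 : ‖x‖ * ‖g‖ * ‖y‖ ≤ (√p * ‖x‖) * (√q * ‖y‖) := by
    calc ‖x‖ * ‖g‖ * ‖y‖ ≤ ‖x‖ * (√p * √q) * ‖y‖ := by gcongr
      _ = _ := by ring
  have h2 := two_mul_le_add_sq (√p * ‖x‖) (√q * ‖y‖)
  rw [mul_pow, mul_pow, Real.sq_sqrt hp0, Real.sq_sqrt hq0] at h2
  linarith

/-- If `muDiag A ≤ 1`, then any matrix with the same diagonal, the same product of off-diagonal
entries, and off-diagonal entries of equal modulus, is a contraction. -/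
lemma contraction_of_muDiag_le_one {A : Matrix (Fin 2) (Fin 2) ℂ} (hA : muDiag A ≤ 1) {b c : ℂ}
    (hbc : b * c = A 0 1 * A 1 0) (hnorm : ‖b‖ = ‖c‖) (x y : ℂ) :
    ‖A 0 0 * x + b * y‖ ^ 2 + ‖c * x + A 1 1 * y‖ ^ 2 ≤ ‖x‖ ^ 2 + ‖y‖ ^ 2 := by
  refine contraction_of_tetrablock _ _ _ _ hnorm (fun x y hx hy h0 => ?_) x y
  have := (muDiag_le_one_iff A).mp hA (Matrix.diagonal ![x, y])
    (Matrix.isDiag_diagonal _) (by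
      rw [← h0, hbc]
      simp [Matrix.det_fin_two, Matrix.mul_diagonal]
      ring)
  exact absurd (opNorm2_diagonal_lt_one hx hy) (not_lt.mpr this)

/-- `muDiag A ≤ 1` if `A` has the same diagonal and the same product of off-diagonal entries as a
contraction. -/
lemma muDiag_le_one_of_opNorm2_le_one {A G : Matrix (Fin 2) (Fin 2) ℂ} (hG : opNorm2 G ≤ 1)
    (h00 : A 0 0 = G 0 0) (h11 : A 1 1 = G 1 1) (hoff : A 0 1 * A 1 0 = G 0 1 * G 1 0) :
    muDiag A ≤ 1 := by
  rw [muDiag_le_one_iff]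
  intro X hX hdet
  have hX01 : X 0 1 = 0 := hX (by decide)
  have hX10 : X 1 0 = 0 := hX (by decide)
  have hdet' : (1 - G * X).det = 0 := by
    rw [← hdet]
    simp only [Matrix.det_fin_two, Matrix.sub_apply, Matrix.mul_apply, Fin.sum_univ_two, hX01,
      hX10, h00, h11, Matrix.one_apply_eq, ne_eq, zero_ne_one, not_false_eq_true,
      Matrix.one_apply_ne, one_ne_zero]
    linear_combination X 0 0 * X 1 1 * hoff
  obtain ⟨v, hv, hv0⟩ := Matrix.exists_mulVec_eq_zero_iff.mpr hdet'
  have hv' : v = G *ᵥ (X *ᵥ v) := by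
    rw [Matrix.sub_mulVec, Matrix.one_mulVec, sub_eq_zero] at hv0
    rw [Matrix.mulVec_mulVec]; exact hv0
  have hpos : 0 < ‖WithLp.toLp 2 v‖ := by
    rw [norm_pos_iff]; simpa using hv
  have h1 : ‖WithLp.toLp 2 v‖ ≤ 1 * (opNorm2 X * ‖WithLp.toLp 2 v‖) := by
    conv_lhs => rw [hv']
    rw [← Matrix.toEuclideanCLM_toLp, ← Matrix.toEuclideanCLM_toLp]
    refine (ContinuousLinearMap.le_of_opNorm_le _ hG _).trans ?_
    gcongr
    exact ContinuousLinearMap.le_opNorm _ _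
  rw [one_mul] at h1
  exact (le_mul_iff_one_le_left hpos).mp h1

section PickNecessity

open Metric Real

/-- The analytic (on the exterior of the disc) combination of Cauchy kernels, as it restricts to
the unit circle. -/
noncomputable def cauchyComb {ι : Type*} [Fintype ι] (lam x : ι → ℂ) (z : ℂ) : ℂ :=
  ∑ k, x k * (z / (z - lam k))

lemma continuousOn_cauchyComb {ι : Type*} [Fintype ι] {lam : ι → ℂ}
    (hlam : ∀ k, lam k ∈ ball (0 : ℂ) 1) (x : ι → ℂ) :
    ContinuousOn (cauchyComb lam x) (sphere 0 1) := by
  unfold cauchyComb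
  refine continuousOn_finsetSum _ fun k _ => continuousOn_const.mul ?_
  refine continuousOn_id.div (continuousOn_id.sub continuousOn_const) fun z hz h => ?_
  have h1 := hlam k
  replace h : z = lam k := sub_eq_zero.mp h
  rw [mem_sphere_zero_iff_norm] at hz
  rw [mem_ball_zero_iff] at h1
  rw [← h] at h1
  linarith

lemma circleAverage_cauchyComb {ι : Type*} [Fintype ι] {lam : ι → ℂ}
    (hlam : ∀ k, lam k ∈ ball (0 : ℂ) 1) {f : ℂ → ℂ} (hf : DiffContOnCl ℂ f (ball 0 1))
    (x y : ι → ℂ) :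
    circleAverage (fun z => (starRingEnd ℂ) (cauchyComb lam y z) * (f z * cauchyComb lam x z)) 0 1 =
      ∑ k, ∑ l, (starRingEnd ℂ) (y k) * x l * f (lam l) /
        (1 - (starRingEnd ℂ) (lam k) * lam l) := by
  have hnorm : ∀ k, ‖lam k‖ < 1 := fun k => by simpa using hlam k
  have hfc : ContinuousOn f (closedBall 0 1) := by
    have := hf.2; rwa [closure_ball _ one_ne_zero] at this
  have hne : ∀ k, ∀ z : ℂ, ‖z‖ ≤ 1 → 1 - (starRingEnd ℂ) (lam k) * z ≠ 0 := by
    intro k z hz h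
    have h1 : ‖(starRingEnd ℂ) (lam k) * z‖ = 1 := by
      rw [← sub_eq_zero.mp h]; simp
    rw [norm_mul, Complex.norm_conj] at h1
    nlinarith [hnorm k, norm_nonneg z, norm_nonneg (lam k)]
  have hpt : ∀ z ∈ sphere (0 : ℂ) |1|,
      (starRingEnd ℂ) (cauchyComb lam y z) * (f z * cauchyComb lam x z) =
      ∑ k, ∑ l, ((starRingEnd ℂ) (y k) * x l) • ((z - 0) / (z - lam l)) •
        (f z / (1 - (starRingEnd ℂ) (lam k) * z)) := by
    intro z hz
    rw [abs_one, mem_sphere_zero_iff_norm] at hz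
    unfold cauchyComb
    have hz0 : z ≠ 0 := by rintro rfl; simp at hz
    have hconj : (starRingEnd ℂ) z = z⁻¹ := by
      rw [Complex.inv_def, Complex.normSq_eq_norm_sq, hz]; simp
    rw [map_sum, Finset.mul_sum, Finset.sum_mul_sum]
    refine Finset.sum_congr rfl fun k _ => Finset.sum_congr rfl fun l _ => ?_
    rw [map_mul, map_div₀, map_sub, hconj, smul_eq_mul, smul_eq_mul, sub_zero]
    have h2 : z⁻¹ / (z⁻¹ - (starRingEnd ℂ) (lam k)) = 1 / (1 - (starRingEnd ℂ) (lam k) * z) := by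
      rw [← mul_div_mul_left _ _ hz0, mul_inv_cancel₀ hz0, mul_sub, mul_inv_cancel₀ hz0, mul_comm z]
    rw [h2]
    ring
  rw [circleAverage_congr_sphere hpt]
  have hdc : ∀ k, DiffContOnCl ℂ (fun z => f z / (1 - (starRingEnd ℂ) (lam k) * z)) (ball 0 1) := by
    intro k
    constructor
    · refine hf.1.div (by fun_prop) fun z hz => hne k z (by simpa using (mem_ball.mp hz).le)
    · rw [closure_ball _ one_ne_zero]
      exact hfc.div (by fun_prop) fun z hz => hne k z (by simpa using hz)
  have hint : ∀ k l, CircleIntegrable (fun z => ((starRingEnd ℂ) (y k) * x l) •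
      ((z - 0) / (z - lam l)) • (f z / (1 - (starRingEnd ℂ) (lam k) * z))) 0 1 := by
    intro k l
    refine ContinuousOn.circleIntegrable zero_le_one ?_
    simp only [smul_eq_mul]
    refine continuousOn_const.mul (ContinuousOn.mul ?_ ?_)
    · refine ContinuousOn.div (by fun_prop) (by fun_prop) fun z hz h => ?_
      rw [sub_eq_zero] at h
      rw [mem_sphere_zero_iff_norm, h] at hz
      linarith [hnorm l]
    · exact (hfc.mono sphere_subset_closedBall).div (by fun_prop) fun z hz =>
        hne k z (by simpa using (mem_sphere.mp hz).le)
  rw [circleAverage_fun_sum fun k _ => CircleIntegrable.fun_sum _ fun l _ => hint k l]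
  refine Finset.sum_congr rfl fun k _ => ?_
  rw [circleAverage_fun_sum fun l _ => hint k l]
  refine Finset.sum_congr rfl fun l _ => ?_
  rw [circleAverage_fun_smul, DiffContOnCl.circleAverage_smul_div (by simpa using hdc k)
    (by simpa using hlam l), smul_eq_mul]
  ring

/-- The Pick matrix of the interpolation data `lam k ↦ V k`. -/
noncomputable def pickMatrix {ι : Type*} (lam : ι → ℂ) (V : ι → Matrix (Fin 2) (Fin 2) ℂ) :
    Matrix (ι × Fin 2) (ι × Fin 2) ℂ :=
  Matrix.of (fun p q => ((1 - (V p.1)ᴴ * V q.1) p.2 q.2) /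
    (1 - (starRingEnd ℂ) (lam p.1) * lam q.1))

lemma isHermitian_pickMatrix {ι : Type*} (lam : ι → ℂ) (V : ι → Matrix (Fin 2) (Fin 2) ℂ) :
    (pickMatrix lam V).IsHermitian := by
  ext p q
  have h : (1 - (V p.1)ᴴ * V q.1)ᴴ = 1 - (V q.1)ᴴ * V p.1 := by
    simp [Matrix.conjTranspose_mul]
  simp only [pickMatrix, Matrix.conjTranspose_apply, Matrix.of_apply, ← h, star_div₀]
  simp [mul_comm]

/-- **Necessity of the Pick condition** for matrix functions that are contractive on the circle. -/
theorem posSemidef_pickMatrix {ι : Type*} [Fintype ι] {lam : ι → ℂ}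
    (hlam : ∀ k, lam k ∈ ball (0 : ℂ) 1) {G : ℂ → Matrix (Fin 2) (Fin 2) ℂ}
    (hG : ∀ i j, DiffContOnCl ℂ (fun z => G z i j) (ball 0 1))
    (hcontr : ∀ z ∈ sphere (0 : ℂ) 1, ∀ x y : ℂ,
      ‖G z 0 0 * x + G z 0 1 * y‖ ^ 2 + ‖G z 1 0 * x + G z 1 1 * y‖ ^ 2 ≤ ‖x‖ ^ 2 + ‖y‖ ^ 2) :
    (pickMatrix lam (fun k => G (lam k))).PosSemidef := by
  refine .of_dotProduct_mulVec_nonneg (isHermitian_pickMatrix _ _) fun x => ?_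
  have him := (isHermitian_pickMatrix lam (fun k => G (lam k))).im_star_dotProduct_mulVec_self x
  refine Complex.nonneg_iff.mpr ⟨?_, him.symm⟩
  set u : Fin 2 → ι → ℂ := fun i k => x (k, i) with hu
  set v : Fin 2 → ι → ℂ := fun i k => ∑ j, G (lam k) i j * x (k, j) with hv
  set C := cauchyComb lam with hC
  have hone : DiffContOnCl ℂ (fun _ : ℂ => (1 : ℂ)) (ball 0 1) := diffContOnCl_const
  have hint : ∀ (f : ℂ → ℂ), DiffContOnCl ℂ f (ball 0 1) → ∀ a b : ι → ℂ,
      CircleIntegrable (fun z => (starRingEnd ℂ) (C a z) * (f z * C b z)) 0 1 := by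
    intro f hf a b
    refine ContinuousOn.circleIntegrable zero_le_one ?_
    have hfc : ContinuousOn f (sphere 0 1) := by
      have := hf.2
      rw [closure_ball _ one_ne_zero] at this
      exact this.mono sphere_subset_closedBall
    exact (Complex.continuous_conj.comp_continuousOn (continuousOn_cauchyComb hlam a)).mul
      (hfc.mul (continuousOn_cauchyComb hlam b))
  set H : ℂ → ℂ := fun z => ∑ i, ((starRingEnd ℂ) (C (u i) z) * (1 * C (u i) z) +
    (starRingEnd ℂ) (C (v i) z) * (1 * C (v i) z) -
    (2 : ℂ) • ∑ j, (starRingEnd ℂ) (C (v i) z) * (G z i j * C (u j) z)) with hH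
  have hint1 : ∀ i, CircleIntegrable (fun z => (starRingEnd ℂ) (C (u i) z) * (1 * C (u i) z) +
      (starRingEnd ℂ) (C (v i) z) * (1 * C (v i) z)) 0 1 :=
    fun i => (hint _ hone _ _).add (hint _ hone _ _)
  have hint2 : ∀ i, CircleIntegrable (fun z => (2 : ℂ) •
      ∑ j, (starRingEnd ℂ) (C (v i) z) * (G z i j * C (u j) z)) 0 1 :=
    fun i => (CircleIntegrable.fun_sum _ fun j _ => hint _ (hG i j) _ _).const_fun_smul
  have hint3 : ∀ i, CircleIntegrable (fun z => (starRingEnd ℂ) (C (u i) z) * (1 * C (u i) z) +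
      (starRingEnd ℂ) (C (v i) z) * (1 * C (v i) z) -
      (2 : ℂ) • ∑ j, (starRingEnd ℂ) (C (v i) z) * (G z i j * C (u j) z)) 0 1 :=
    fun i => (hint1 i).sub (hint2 i)
  have hHint : CircleIntegrable H 0 1 := CircleIntegrable.fun_sum _ fun i _ => hint3 i
  have hHre : ∀ z ∈ sphere (0 : ℂ) |1|, 0 ≤ (H z).re := by
    intro z hz
    rw [abs_one] at hz
    have h1 := hcontr z hz (C (u 0) z) (C (u 1) z)
    have h2 : (H z).re = ‖C (u 0) z‖ ^ 2 + ‖C (u 1) z‖ ^ 2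
        - (‖G z 0 0 * C (u 0) z + G z 0 1 * C (u 1) z‖ ^ 2
          + ‖G z 1 0 * C (u 0) z + G z 1 1 * C (u 1) z‖ ^ 2)
        + ‖G z 0 0 * C (u 0) z + G z 0 1 * C (u 1) z - C (v 0) z‖ ^ 2
        + ‖G z 1 0 * C (u 0) z + G z 1 1 * C (u 1) z - C (v 1) z‖ ^ 2 := by
      simp only [hH, Fin.sum_univ_two, smul_eq_mul]
      generalize C (u 0) z = a₀
      generalize C (u 1) z = a₁
      generalize C (v 0) z = b₀
      generalize C (v 1) z = b₁
      simp only [Complex.sq_norm, Complex.normSq_apply, Complex.sub_re, Complex.sub_im,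
        Complex.add_re, Complex.add_im, Complex.mul_re, Complex.mul_im, Complex.conj_re,
        Complex.conj_im, Complex.one_re, Complex.one_im, Complex.re_ofNat, Complex.im_ofNat]
      ring
    rw [h2]
    have := sq_nonneg ‖G z 0 0 * C (u 0) z + G z 0 1 * C (u 1) z - C (v 0) z‖
    have := sq_nonneg ‖G z 1 0 * C (u 0) z + G z 1 1 * C (u 1) z - C (v 1) z‖
    linarith
  have havg : circleAverage H 0 1 =
      star x ⬝ᵥ (pickMatrix lam (fun k => G (lam k)) *ᵥ x) := by
    have hsum : ∀ i, circleAverage (fun z => (starRingEnd ℂ) (C (u i) z) * (1 * C (u i) z) +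
        (starRingEnd ℂ) (C (v i) z) * (1 * C (v i) z) -
        (2 : ℂ) • ∑ j, (starRingEnd ℂ) (C (v i) z) * (G z i j * C (u j) z)) 0 1 =
        ∑ k, ∑ l, (starRingEnd ℂ) (u i k) * u i l * 1 / (1 - (starRingEnd ℂ) (lam k) * lam l) +
        ∑ k, ∑ l, (starRingEnd ℂ) (v i k) * v i l * 1 / (1 - (starRingEnd ℂ) (lam k) * lam l) -
        2 * ∑ j, ∑ k, ∑ l, (starRingEnd ℂ) (v i k) * u j l * G (lam l) i j /
          (1 - (starRingEnd ℂ) (lam k) * lam l) := by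
      intro i
      rw [circleAverage_fun_sub (hint1 i) (hint2 i),
        circleAverage_fun_add (hint _ hone _ _) (hint _ hone _ _), circleAverage_fun_smul,
        circleAverage_fun_sum fun j _ => hint _ (hG i j) _ _,
        circleAverage_cauchyComb hlam hone, circleAverage_cauchyComb hlam hone, smul_eq_mul]
      congr 2
      exact Finset.sum_congr rfl fun j _ => circleAverage_cauchyComb hlam (hG i j) _ _
    rw [hH, circleAverage_fun_sum fun i _ => hint3 i,
      Finset.sum_congr rfl fun i _ => hsum i]
    simp only [dotProduct, Matrix.mulVec, Fintype.sum_prod_type, Fin.sum_univ_two,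
      Finset.mul_sum, mul_add, ← Finset.sum_add_distrib, ← Finset.sum_sub_distrib]
    refine Finset.sum_congr rfl fun k _ => Finset.sum_congr rfl fun l _ => ?_
    simp only [hu, hv, pickMatrix, Matrix.of_apply, Matrix.sub_apply, Matrix.mul_apply,
      Matrix.conjTranspose_apply, Fin.sum_univ_two, Pi.star_apply, map_add, map_mul,
      Matrix.one_apply_eq, ne_eq, zero_ne_one, not_false_eq_true, Matrix.one_apply_ne,
      one_ne_zero, starRingEnd_apply]
    ring
  rw [← havg]
  have hcomm := Complex.reCLM.circleAverage_comp_comm hHint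
  rw [Complex.reCLM_apply] at hcomm
  rw [← hcomm]
  exact circleAverage_nonneg_of_nonneg fun z hz => hHre z hz

end PickNecessity

section Realization

/-- Two finite families with the same Gram matrix are related by a linear isometry. -/
lemma exists_linearIsometry_of_inner_eq {ι H : Type*} [Fintype ι] [NormedAddCommGroup H]
    [InnerProductSpace ℂ H] [FiniteDimensional ℂ H] (u v : ι → H)
    (h : ∀ i j, inner ℂ (u i) (u j) = inner ℂ (v i) (v j)) :
    ∃ T : H →ₗᵢ[ℂ] H, ∀ i, T (u i) = v i := by
  classical
  set f : (ι → ℂ) →ₗ[ℂ] H := Fintype.linearCombination ℂ u with hf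
  set g : (ι → ℂ) →ₗ[ℂ] H := Fintype.linearCombination ℂ v with hg
  have hnorm : ∀ x, ‖g x‖ = ‖f x‖ := by
    intro x
    have : (inner ℂ (g x) (g x) : ℂ) = inner ℂ (f x) (f x) := by
      simp only [hf, hg, Fintype.linearCombination_apply, sum_inner, inner_sum, inner_smul_left,
        inner_smul_right, h]
    rw [inner_self_eq_norm_sq_to_K, inner_self_eq_norm_sq_to_K] at this
    have h2 : ‖g x‖ ^ 2 = ‖f x‖ ^ 2 := by exact_mod_cast this
    exact (pow_left_inj₀ (norm_nonneg _) (norm_nonneg _) two_ne_zero).mp h2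
  obtain ⟨s, hs⟩ := f.rangeRestrict.exists_rightInverse_of_surjective f.range_rangeRestrict
  have hs' : ∀ y, f (s y) = y := fun y =>
    congrArg Subtype.val (LinearMap.congr_fun hs y)
  have hgs : ∀ x, g (s (f.rangeRestrict x)) = g x := by
    intro x
    rw [← sub_eq_zero, ← map_sub, ← norm_eq_zero, hnorm, map_sub, hs']
    simp
  let L : LinearMap.range f →ₗᵢ[ℂ] H := ⟨g ∘ₗ s, fun y => by
    rw [LinearMap.comp_apply, hnorm, hs']; rfl⟩
  refine ⟨L.extend, fun i => ?_⟩
  have hfi : f (Pi.single i 1) = u i := by simp [hf, Fintype.linearCombination_apply_single]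
  have hgi : g (Pi.single i 1) = v i := by simp [hg, Fintype.linearCombination_apply_single]
  have := L.extend_apply (f.rangeRestrict (Pi.single i 1))
  rw [LinearMap.codRestrict_apply, hfi] at this
  rw [this, ← hgi, ← hgs]
  rfl

lemma differentiableAt_inverse_one_sub_smul {A : Type*} [NormedRing A] [NormedAlgebra ℂ A]
    [CompleteSpace A] {a : A} {z : ℂ} (h : IsUnit (1 - z • a)) :
    DifferentiableAt ℂ (fun z : ℂ => Ring.inverse (1 - z • a)) z :=
  (differentiableAt_inverse (𝕜 := ℂ) h).comp z
    (f := fun z : ℂ => 1 - z • a) (by fun_prop)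

/-- The transfer function of an isometric colligation `T` is analytic and contractive, and its
values are determined by the equation `T (x, z • y) = (G z x, y)`. -/
lemma exists_transferFunction {E K : Type*} [NormedAddCommGroup E] [InnerProductSpace ℂ E]
    [NormedAddCommGroup K] [InnerProductSpace ℂ K] [CompleteSpace K]
    (T : WithLp 2 (E × K) →ₗᵢ[ℂ] WithLp 2 (E × K)) :
    ∃ G : ℂ → E →L[ℂ] E,
      DifferentiableOn ℂ G (Metric.ball 0 1) ∧
      (∀ z ∈ Metric.ball (0 : ℂ) 1, ‖G z‖ ≤ 1) ∧
      (∀ z ∈ Metric.ball (0 : ℂ) 1, ∀ x y w,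
        T (WithLp.toLp 2 (x, z • y)) = WithLp.toLp 2 (w, y) → G z x = w) := by
  let S : (E × K) →L[ℂ] WithLp 2 (E × K) := T.toContinuousLinearMap.comp
    (WithLp.prodContinuousLinearEquiv 2 ℂ E K).symm.toContinuousLinearMap
  let P : (E × K) →L[ℂ] E := (WithLp.fstL 2 ℂ E K).comp S
  let Q : (E × K) →L[ℂ] K := (WithLp.sndL 2 ℂ E K).comp S
  have hT : ∀ x y, T (WithLp.toLp 2 (x, y)) = WithLp.toLp 2 (P (x, y), Q (x, y)) := fun x y => rfl
  let A : K →L[ℂ] K := Q.comp (ContinuousLinearMap.inr ℂ E K)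
  have hPlin : ∀ x y, P (x, y) = P (x, 0) + P (0, y) := fun x y => by rw [← map_add]; simp
  have hQlin : ∀ x y, Q (x, y) = Q (x, 0) + Q (0, y) := fun x y => by rw [← map_add]; simp
  have hnorm : ∀ x y, ‖P (x, y)‖ ^ 2 + ‖Q (x, y)‖ ^ 2 = ‖x‖ ^ 2 + ‖y‖ ^ 2 := by
    intro x y
    have h := T.norm_map (WithLp.toLp 2 (x, y))
    rw [hT] at h
    have h2 := congrArg (· ^ 2) h
    simpa [WithLp.prod_norm_sq_eq_of_L2] using h2
  have hA : ‖A‖ ≤ 1 := by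
    refine ContinuousLinearMap.opNorm_le_bound _ zero_le_one fun y => ?_
    have h := hnorm 0 y
    rw [one_mul]
    refine (pow_le_pow_iff_left₀ (norm_nonneg _) (norm_nonneg _) two_ne_zero).mp ?_
    rw [norm_zero] at h
    change ‖Q (0, y)‖ ^ 2 ≤ _
    nlinarith [sq_nonneg ‖P (0, y)‖]
  have hunit : ∀ z ∈ Metric.ball (0 : ℂ) 1, IsUnit (1 - z • A) := by
    intro z hz
    refine isUnit_one_sub_of_norm_lt_one ?_
    rw [norm_smul]
    rw [mem_ball_zero_iff] at hz
    nlinarith [norm_nonneg z, norm_nonneg A]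
  let R : ℂ → K →L[ℂ] K := fun z => Ring.inverse (1 - z • A)
  let G : ℂ → E →L[ℂ] E := fun z => P.comp (ContinuousLinearMap.inl ℂ E K) +
    z • (P.comp (ContinuousLinearMap.inr ℂ E K)).comp
      ((R z).comp (Q.comp (ContinuousLinearMap.inl ℂ E K)))
  have hR : ∀ z ∈ Metric.ball (0 : ℂ) 1, ∀ x, Q (x, z • R z (Q (x, 0))) = R z (Q (x, 0)) := by
    intro z hz x
    have h1 := congrArg (fun L : K →L[ℂ] K => L (Q (x, 0))) (Ring.mul_inverse_cancel _ (hunit z hz))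
    have h2 : R z (Q (x, 0)) - z • Q (0, R z (Q (x, 0))) = Q (x, 0) := h1
    rw [hQlin, show ((0 : E), z • R z (Q (x, 0))) = z • ((0 : E), R z (Q (x, 0))) by simp, map_smul]
    exact (sub_eq_iff_eq_add.mp h2).symm
  have hG : ∀ z x, G z x = P (x, z • R z (Q (x, 0))) := by
    intro z x
    rw [hPlin, show ((0 : E), z • R z (Q (x, 0))) = z • ((0 : E), R z (Q (x, 0))) by simp, map_smul]
    rfl
  refine ⟨G, fun z hz => ?_, fun z hz => ?_, fun z hz x y w h => ?_⟩
  · have hRd : DifferentiableAt ℂ R z :=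
      differentiableAt_inverse_one_sub_smul (hunit z hz)
    refine DifferentiableAt.differentiableWithinAt ?_
    have h := (differentiableAt_const (𝕜 := ℂ) (x := z)
      (P.comp (ContinuousLinearMap.inr ℂ E K))).clm_comp
      (hRd.clm_comp (differentiableAt_const (Q.comp (ContinuousLinearMap.inl ℂ E K))))
    exact (differentiableAt_const _).add (DifferentiableAt.fun_smul differentiableAt_fun_id h)
  · refine ContinuousLinearMap.opNorm_le_bound _ zero_le_one fun x => ?_
    rw [one_mul]
    refine (pow_le_pow_iff_left₀ (norm_nonneg _) (norm_nonneg _) two_ne_zero).mp ?_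
    have h := hnorm x (z • R z (Q (x, 0)))
    rw [hR z hz, ← hG, norm_smul, mul_pow] at h
    rw [mem_ball_zero_iff] at hz
    nlinarith [mul_le_of_le_one_left (sq_nonneg ‖R z (Q (x, 0))‖)
      (pow_le_one₀ (norm_nonneg z) hz.le (n := 2))]
  · rw [hT] at h
    have h' := congrArg WithLp.ofLp h
    simp only [Prod.mk.injEq] at h'
    obtain ⟨h1, h2⟩ := h'
    have h3 : R z (Q (x, 0)) = y := by
      have h4 : (1 - z • A) y = Q (x, 0) := by
        change y - z • Q (0, y) = _
        rw [hQlin, show ((0 : E), z • y) = z • ((0 : E), y) by simp, map_smul] at h2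
        rw [sub_eq_iff_eq_add]; exact h2.symm
      rw [← h4]
      exact congrArg (fun L : K →L[ℂ] K => L y) (Ring.inverse_mul_cancel _ (hunit z hz))
    rw [hG, h3, h1]

open scoped MatrixOrder in
/-- **Sufficiency of the Pick condition**: a positive semidefinite Pick matrix yields an analytic
contractive interpolant on the unit disc. -/
theorem exists_interpolant_of_posSemidef_pickMatrix {ι : Type*} [Fintype ι] [DecidableEq ι]
    {lam : ι → ℂ} (hlam : ∀ k, lam k ∈ Metric.ball (0 : ℂ) 1)
    {V : ι → Matrix (Fin 2) (Fin 2) ℂ} (hP : (pickMatrix lam V).PosSemidef) :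
    ∃ G : ℂ → Matrix (Fin 2) (Fin 2) ℂ,
      (∀ i j, DifferentiableOn ℂ (fun z => G z i j) (Metric.ball (0 : ℂ) 1)) ∧
      (∀ z ∈ Metric.ball (0 : ℂ) 1, opNorm2 (G z) ≤ 1) ∧ ∀ k, G (lam k) = V k := by
  obtain ⟨M, hM⟩ := CStarAlgebra.nonneg_iff_eq_star_mul_self.mp hP.nonneg
  let e : Fin 2 → EuclideanSpace ℂ (Fin 2) := fun i => EuclideanSpace.single i 1
  let m : ι × Fin 2 → EuclideanSpace ℂ (ι × Fin 2) := fun q => WithLp.toLp 2 (M.col q)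
  let w : ι × Fin 2 → EuclideanSpace ℂ (Fin 2) := fun q => WithLp.toLp 2 ((V q.1).col q.2)
  have hinner : ∀ p q, inner ℂ (m p) (m q) = pickMatrix lam V p q := by
    intro p q
    rw [hM, Matrix.star_eq_conjTranspose, Matrix.mul_apply]
    simp [m, PiLp.inner_apply, mul_comm]
  obtain ⟨T, hT⟩ := exists_linearIsometry_of_inner_eq
    (H := WithLp 2 (EuclideanSpace ℂ (Fin 2) × EuclideanSpace ℂ (ι × Fin 2)))
    (fun q : ι × Fin 2 => WithLp.toLp 2 (e q.2, lam q.1 • m q))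
    (fun q => WithLp.toLp 2 (w q, m q)) (by
      intro p q
      have hne : 1 - (starRingEnd ℂ) (lam p.1) * lam q.1 ≠ 0 := by
        intro h
        have h1 : ‖(starRingEnd ℂ) (lam p.1) * lam q.1‖ = 1 := by
          rw [← sub_eq_zero.mp h]; simp
        rw [norm_mul, Complex.norm_conj] at h1
        have hp := mem_ball_zero_iff.mp (hlam p.1)
        have hq := mem_ball_zero_iff.mp (hlam q.1)
        nlinarith [norm_nonneg (lam p.1), norm_nonneg (lam q.1)]
      have h1 : inner ℂ (e p.2) (e q.2) = (1 : Matrix (Fin 2) (Fin 2) ℂ) p.2 q.2 := by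
        simp only [e, EuclideanSpace.inner_single_left, Matrix.one_apply]
        simp
      have h2 : inner ℂ (w p) (w q) = ((V p.1)ᴴ * V q.1) p.2 q.2 := by
        simp [w, PiLp.inner_apply, mul_comm, Matrix.mul_apply]
      have h3 : pickMatrix lam V p q * (1 - (starRingEnd ℂ) (lam p.1) * lam q.1) =
          (1 : Matrix (Fin 2) (Fin 2) ℂ) p.2 q.2 - ((V p.1)ᴴ * V q.1) p.2 q.2 :=
        div_mul_cancel₀ _ hne
      simp only [WithLp.prod_inner_apply, inner_smul_left, inner_smul_right, hinner, h1, h2]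
      linear_combination -h3)
  obtain ⟨G, hGd, hGn, hGi⟩ := exists_transferFunction T
  have hentry : ∀ (L : EuclideanSpace ℂ (Fin 2) →L[ℂ] EuclideanSpace ℂ (Fin 2)) i j,
      (Matrix.toEuclideanCLM (n := Fin 2) (𝕜 := ℂ)).symm L i j = L (e j) i := by
    intro L i j
    obtain ⟨A, hA⟩ : ∃ A, A = (Matrix.toEuclideanCLM (n := Fin 2) (𝕜 := ℂ)).symm L := ⟨_, rfl⟩
    rw [← hA, ← (Matrix.toEuclideanCLM (n := Fin 2) (𝕜 := ℂ)).apply_symm_apply L, ← hA]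
    simp [e, Matrix.ofLp_toEuclideanCLM]
  refine ⟨fun z => (Matrix.toEuclideanCLM (n := Fin 2) (𝕜 := ℂ)).symm (G z), fun i j => ?_,
    fun z hz => ?_, fun k => ?_⟩
  · simp only [hentry]
    exact (EuclideanSpace.proj (𝕜 := ℂ) i).differentiable.comp_differentiableOn
      (hGd.clm_apply (differentiableOn_const (e j)))
  · simpa [opNorm2] using hGn z hz
  · ext i j
    refine (hentry _ i j).trans ?_
    rw [hGi _ (hlam k) (e j) (m (k, j)) (w (k, j)) (hT (k, j))]
    rfl

end Realization

section BalancedFactorization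

open Metric Filter Topology

/-- `p` is, on the closed unit disc, a product of two functions of the disc algebra which have equal
modulus on the unit circle. -/
def IsBalancedProduct (p : ℂ → ℂ) : Prop :=
  ∃ b c : ℂ → ℂ, DiffContOnCl ℂ b (ball 0 1) ∧ DiffContOnCl ℂ c (ball 0 1) ∧
    (∀ z ∈ closedBall (0 : ℂ) 1, b z * c z = p z) ∧ ∀ z ∈ sphere (0 : ℂ) 1, ‖b z‖ = ‖c z‖

lemma sq_cpow_inv_two (w : ℂ) : (w ^ (2 : ℂ)⁻¹) ^ 2 = w := by
  exact_mod_cast Complex.cpow_nat_inv_pow w two_ne_zero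

namespace IsBalancedProduct

lemma congr {p q : ℂ → ℂ} (hp : IsBalancedProduct p) (h : Set.EqOn p q (closedBall 0 1)) :
    IsBalancedProduct q := by
  obtain ⟨b, c, hb, hc, hbc, hn⟩ := hp
  exact ⟨b, c, hb, hc, fun _ hz => (hbc _ hz).trans (h hz), hn⟩

lemma mul {p q : ℂ → ℂ} (hp : IsBalancedProduct p) (hq : IsBalancedProduct q) :
    IsBalancedProduct (p * q) := by
  obtain ⟨b, c, hb, hc, hbc, hn⟩ := hp
  obtain ⟨b', c', hb', hc', hbc', hn'⟩ := hq
  refine ⟨b * b', c * c', hb.smul hb', hc.smul hc', fun z hz => ?_, fun z hz => ?_⟩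
  · rw [Pi.mul_apply, Pi.mul_apply, Pi.mul_apply, ← hbc z hz, ← hbc' z hz]
    ring
  · rw [Pi.mul_apply, Pi.mul_apply, norm_mul, norm_mul, hn z hz, hn' z hz]

lemma sq {s : ℂ → ℂ} (hs : DiffContOnCl ℂ s (ball 0 1)) : IsBalancedProduct (fun z => s z ^ 2) :=
  ⟨s, s, hs, hs, fun _ _ => (pow_two _).symm, fun _ _ => rfl⟩

lemma const (a : ℂ) : IsBalancedProduct (fun _ => a) := by
  refine (sq (s := fun _ => a ^ (2 : ℂ)⁻¹) diffContOnCl_const).congr fun z _ => ?_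
  exact sq_cpow_inv_two a

lemma pow {p : ℂ → ℂ} (hp : IsBalancedProduct p) (n : ℕ) : IsBalancedProduct (p ^ n) := by
  induction n with
  | zero => exact (const 1).congr fun _ _ => by simp
  | succ n ih => rw [pow_succ]; exact ih.mul hp

lemma prod {ι : Type*} (s : Finset ι) {p : ι → ℂ → ℂ} (hp : ∀ i ∈ s, IsBalancedProduct (p i)) :
    IsBalancedProduct (∏ i ∈ s, p i) :=
  Finset.prod_induction p IsBalancedProduct (fun _ _ => mul) (const 1) hp

end IsBalancedProduct

lemma diffContOnCl_sqrt_one_sub_mul {a : ℂ} (ha : ‖a‖ ≤ 1) :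
    DiffContOnCl ℂ (fun z => (1 - a * z) ^ (2 : ℂ)⁻¹) (ball 0 1) := by
  have hre : ∀ z, ‖a * z‖ < 1 → 1 - a * z ∈ Complex.slitPlane := fun z hz => by
    refine Or.inl ?_
    rw [Complex.sub_re, Complex.one_re]
    linarith [Complex.re_le_norm (a * z)]
  constructor
  · intro z hz
    rw [mem_ball_zero_iff] at hz
    refine DifferentiableAt.differentiableWithinAt ?_
    refine DifferentiableAt.cpow_const ?_ (hre z ?_)
    · fun_prop
    · rw [norm_mul]; nlinarith [norm_nonneg a, norm_nonneg z]
  · rw [closure_ball _ one_ne_zero]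
    intro z hz
    rw [mem_closedBall_zero_iff] at hz
    refine ContinuousAt.continuousWithinAt ?_
    have hz1 : ‖a * z‖ ≤ 1 := by
      rw [norm_mul]; exact mul_le_one₀ ha (norm_nonneg _) hz
    by_cases h0 : 1 - a * z = 0
    · have h := Complex.continuousAt_cpow_zero_of_re_pos (z := (2 : ℂ)⁻¹) (by norm_num)
      rw [← h0] at h
      exact ContinuousAt.comp (f := fun z : ℂ => (1 - a * z, (2 : ℂ)⁻¹)) (x := z) h (by fun_prop)
    · refine ContinuousAt.cpow (by fun_prop) continuousAt_const ?_
      by_contra hs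
      rw [Complex.mem_slitPlane_iff, not_or, not_lt, not_not] at hs
      obtain ⟨h1, h2⟩ := hs
      refine h0 (Complex.ext (le_antisymm h1 ?_) h2)
      rw [Complex.sub_re, Complex.one_re, Complex.zero_re]
      linarith [Complex.re_le_norm (a * z)]

lemma isBalancedProduct_sub (u : ℂ) : IsBalancedProduct (fun z => z - u) := by
  rcases lt_or_ge ‖u‖ 1 with hu | hu
  · have hs := diffContOnCl_sqrt_one_sub_mul (a := (starRingEnd ℂ) u) (by simpa using hu.le)
    have hne : ∀ z ∈ closedBall (0 : ℂ) 1, (1 - (starRingEnd ℂ) u * z) ^ (2 : ℂ)⁻¹ ≠ 0 := by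
      intro z hz h
      have h1 := sq_cpow_inv_two (1 - (starRingEnd ℂ) u * z)
      rw [h, zero_pow two_ne_zero] at h1
      have h2 : ‖(starRingEnd ℂ) u * z‖ = 1 := by rw [← sub_eq_zero.mp h1.symm, norm_one]
      rw [norm_mul, Complex.norm_conj] at h2
      rw [mem_closedBall_zero_iff] at hz
      nlinarith [norm_nonneg u, norm_nonneg z]
    have hinv := hs.inv (fun z hz => hne z (by rwa [closure_ball _ one_ne_zero] at hz))
    refine ⟨_, _, DiffContOnCl.smul (differentiable_id.sub_const u).diffContOnCl hinv, hs,
      fun z hz => ?_, fun z hz => ?_⟩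
    · simp [hne z hz]
    · have hz' := hne z (sphere_subset_closedBall hz)
      have h1 := congrArg norm (sq_cpow_inv_two (1 - (starRingEnd ℂ) u * z))
      rw [mem_sphere_zero_iff_norm] at hz
      have h2 : ‖z - u‖ = ‖1 - (starRingEnd ℂ) u * z‖ := by
        have hz1 : (starRingEnd ℂ) z * z = 1 := by
          rw [Complex.conj_mul', hz]; simp
        have : 1 - (starRingEnd ℂ) u * z = (starRingEnd ℂ) (z - u) * z := by
          rw [map_sub, sub_mul, hz1]
        rw [this, norm_mul, Complex.norm_conj, hz, mul_one]
      rw [norm_pow, ← h2] at h1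
      simp only [Pi.inv_apply, id, smul_eq_mul, norm_mul, norm_inv]
      rw [← h1, pow_two, mul_assoc, mul_inv_cancel₀ (norm_ne_zero_iff.mpr hz'), mul_one]
  · have hu0 : u ≠ 0 := norm_pos_iff.mp (by linarith)
    have hs := diffContOnCl_sqrt_one_sub_mul (a := u⁻¹) (by
      rw [norm_inv]; exact inv_le_one_of_one_le₀ hu)
    refine ((IsBalancedProduct.const (-u)).mul (.sq hs)).congr fun z _ => ?_
    rw [Pi.mul_apply]
    simp only [sq_cpow_inv_two]
    field_simp
    ring

/-- A nonvanishing holomorphic function on a disc is a square. -/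
lemma exists_sq_eq_of_ne_zero {g : ℂ → ℂ} {R : ℝ} (hR : 0 < R)
    (hg : DifferentiableOn ℂ g (ball 0 R)) (h0 : ∀ z ∈ ball (0 : ℂ) R, g z ≠ 0) :
    ∃ s : ℂ → ℂ, DifferentiableOn ℂ s (ball 0 R) ∧ ∀ z ∈ ball (0 : ℂ) R, s z ^ 2 = g z := by
  have hd := (hg.deriv isOpen_ball).div hg h0
  obtain ⟨L, hL0, hL⟩ := hd.isExactOn_ball.with_val_at 0 (Complex.log (g 0))
  have hmem : (0 : ℂ) ∈ ball (0 : ℂ) R := mem_ball_self hR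
  have hLd : DifferentiableOn ℂ L (ball 0 R) := fun z hz =>
    (hL z hz).differentiableAt.differentiableWithinAt
  refine ⟨fun z => Complex.exp (L z / 2), (hLd.div_const 2).cexp, fun z hz => ?_⟩
  have hconst : g z * Complex.exp (-L z) = g 0 * Complex.exp (-L 0) := by
    refine (convex_ball (0 : ℂ) R).is_const_of_fderivWithin_eq_zero (𝕜 := ℂ)
      (f := fun z => g z * Complex.exp (-L z)) (hg.mul hLd.neg.cexp) (fun w hw => ?_) hz hmem
    have h1 := (hg.differentiableAt (isOpen_ball.mem_nhds hw)).hasDerivAt.mul (hL w hw).neg.cexp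
    rw [fderivWithin_of_isOpen isOpen_ball hw]
    refine (HasFDerivAt.fderiv (h1.congr_deriv (g' := 0) ?_).hasFDerivAt).trans (by ext; simp)
    have := h0 w hw
    simp only [Pi.div_apply]
    field_simp
    ring
  have h00 := h0 0 hmem
  rw [hL0, Complex.exp_neg, Complex.exp_neg, Complex.exp_log h00, mul_inv_cancel₀ h00,
    mul_inv_eq_one₀ (Complex.exp_ne_zero _)] at hconst
  rw [← Complex.exp_nat_mul, hconst]
  congr 1
  push_cast
  ring

/-- A nonzero holomorphic function on a neighbourhood of the closed unit disc is a product of two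
functions of equal modulus on the unit circle. -/
theorem isBalancedProduct_of_differentiableOn {p : ℂ → ℂ} {R : ℝ} (hR : 1 < R)
    (hp : DifferentiableOn ℂ p (ball 0 R)) {z₀ : ℂ} (hz₀ : z₀ ∈ ball (0 : ℂ) R) (hpz : p z₀ ≠ 0) :
    IsBalancedProduct p := by
  obtain ⟨ρ, h1ρ, hρR⟩ := exists_between hR
  have hsub : closedBall (0 : ℂ) ρ ⊆ ball 0 R := closedBall_subset_ball hρR
  have hpan : AnalyticOnNhd ℂ p (ball 0 R) := hp.analyticOnNhd isOpen_ball
  have hpU : AnalyticOnNhd ℂ p (closedBall 0 ρ) := hpan.mono hsub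
  have hord : ∀ u : closedBall (0 : ℂ) ρ, meromorphicOrderAt p u ≠ ⊤ := by
    intro u htop
    rw [meromorphicOrderAt_eq_top_iff] at htop
    exact hpz (hpan.eqOn_zero_of_preconnected_of_frequently_eq_zero
      (convex_ball 0 R).isPreconnected (hsub u.2) htop.frequently hz₀)
  have hfin := (MeromorphicOn.divisor p (closedBall 0 ρ)).finiteSupport (isCompact_closedBall 0 ρ)
  obtain ⟨g, hg, hg0, hpg⟩ := hpU.meromorphicOn.extract_zeros_poles hord hfin
  set d := MeromorphicOn.divisor p (closedBall 0 ρ) with hd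
  have hdn : 0 ≤ d := MeromorphicOn.AnalyticOnNhd.divisor_nonneg hpU
  have hP : (∏ᶠ u, (· - u) ^ d u : ℂ → ℂ) =
      ∏ u ∈ hfin.toFinset, (fun z => z - u) ^ (d u).toNat := by
    rw [finprod_eq_prod_of_mulSupport_subset (s := hfin.toFinset)]
    · refine Finset.prod_congr rfl fun u _ => ?_
      conv_lhs => rw [← Int.toNat_of_nonneg (hdn u)]
      rw [zpow_natCast]
    · rw [Function.FactorizedRational.mulSupport]; simp
  obtain ⟨s, hs, hsg⟩ := exists_sq_eq_of_ne_zero (zero_lt_one.trans h1ρ)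
    (hg.differentiableOn.mono ball_subset_closedBall)
    fun z hz => hg0 ⟨z, ball_subset_closedBall hz⟩
  have hsc : DiffContOnCl ℂ s (ball 0 1) := by
    refine (hs.mono ?_).diffContOnCl
    rw [closure_ball _ one_ne_zero]
    exact closedBall_subset_ball h1ρ
  refine ((IsBalancedProduct.prod hfin.toFinset fun u _ =>
    (isBalancedProduct_sub u).pow (d u).toNat).mul (.sq hsc)).congr fun z hz => ?_
  have hzρ : z ∈ ball (0 : ℂ) ρ := closedBall_subset_ball h1ρ hz
  have hzU : z ∈ closedBall (0 : ℂ) ρ := ball_subset_closedBall hzρ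
  rw [Pi.mul_apply, hsg z hzρ, ← hP]
  have hPan : AnalyticAt ℂ (∏ᶠ u, (· - u) ^ d u : ℂ → ℂ) z :=
    Function.FactorizedRational.analyticAt (hdn z)
  have hev : ∀ᶠ w in 𝓝[≠] z, p w = ((∏ᶠ u, (· - u) ^ d u : ℂ → ℂ) • g) w := by
    have h := mem_codiscreteWithin_iff_forall_mem_nhdsNE.mp hpg z hzU
    filter_upwards [h, nhdsWithin_le_nhds (isOpen_ball.mem_nhds hzρ)] with w hw hwρ
    exact hw.resolve_right fun hw' => hw' (ball_subset_closedBall hwρ)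
  have := ((hpU z hzU).frequently_eq_iff_eventually_eq (hPan.smul (hg z hzU))).mp hev.frequently
  exact (Filter.Eventually.self_of_nhds this).symm

end BalancedFactorization

section DiagonalInterpolation

open Metric Filter Topology

/-- A diagonal entry of a positive semidefinite Pick matrix bounds the nodal values. -/
lemma norm_le_one_of_posSemidef_pickMatrix {ι : Type*} {lam : ι → ℂ}
    (hlam : ∀ k, lam k ∈ ball (0 : ℂ) 1) {V : ι → Matrix (Fin 2) (Fin 2) ℂ}
    (hP : (pickMatrix lam V).PosSemidef) (k : ι) (i j : Fin 2) : ‖V k i j‖ ≤ 1 := by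
  have h := hP.diag_nonneg (i := (k, j))
  have hk : 0 < 1 - ‖lam k‖ ^ 2 := by
    have := mem_ball_zero_iff.mp (hlam k)
    nlinarith [norm_nonneg (lam k)]
  have heq : pickMatrix lam V (k, j) (k, j) =
      (((1 - (‖V k 0 j‖ ^ 2 + ‖V k 1 j‖ ^ 2)) / (1 - ‖lam k‖ ^ 2) : ℝ) : ℂ) := by
    simp [pickMatrix, Matrix.mul_apply, Complex.conj_mul']
  rw [heq, Complex.zero_le_real, le_div_iff₀ hk, zero_mul] at h
  have hsq : ‖V k i j‖ ^ 2 ≤ 1 := by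
    fin_cases i
    · exact (le_add_of_nonneg_right (sq_nonneg ‖V k 1 j‖)).trans (by simpa using h)
    · exact (le_add_of_nonneg_left (sq_nonneg ‖V k 0 j‖)).trans (by simpa using h)
  exact (sq_le_one_iff₀ (norm_nonneg _)).mp hsq

lemma isClosed_setOf_posSemidef {n : Type*} [Fintype n] :
    IsClosed {A : Matrix n n ℂ | A.PosSemidef} := by
  simp only [Matrix.posSemidef_iff_dotProduct_mulVec, Set.ofPred_and, Set.ofPred_forall]
  refine (isClosed_eq (by fun_prop) continuous_id).inter (isClosed_iInter fun x => ?_)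
  exact isClosed_le continuous_const (by fun_prop)

lemma continuous_pickMatrix {ι : Type*} (lam : ι → ℂ) : Continuous (pickMatrix lam) := by
  refine continuous_matrix fun p q => Continuous.div_const ?_ _
  have h : Continuous fun V : ι → Matrix (Fin 2) (Fin 2) ℂ => 1 - (V p.1)ᴴ * V q.1 := by fun_prop
  exact h.matrix_elem p.2 q.2

/-- For an analytic function with structured singular value at most one, dilated by `r < 1`, the
off-diagonal entries can be rebalanced to make the Pick matrix positive semidefinite. -/
lemma exists_posSemidef_pickMatrix_dilation {ι : Type*} [Fintype ι] {lam : ι → ℂ}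
    (hlam : ∀ k, lam k ∈ ball (0 : ℂ) 1) {F : ℂ → Matrix (Fin 2) (Fin 2) ℂ}
    (hF : ∀ i j, DifferentiableOn ℂ (fun z => F z i j) (ball 0 1))
    (hmu : ∀ z ∈ ball (0 : ℂ) 1, muDiag (F z) ≤ 1) {z₀ : ℂ} (hz₀ : z₀ ∈ ball (0 : ℂ) 1)
    (hF₀ : F z₀ 0 1 * F z₀ 1 0 ≠ 0) {r : ℝ} (hr0 : 0 < r) (hr1 : r < 1) :
    ∃ b c : ι → ℂ, (∀ k, b k * c k = F (r * lam k) 0 1 * F (r * lam k) 1 0) ∧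
      (pickMatrix lam fun k =>
        !![F (r * lam k) 0 0, b k; c k, F (r * lam k) 1 1]).PosSemidef := by
  have hmaps : Set.MapsTo (fun z : ℂ => (r : ℂ) * z) (ball 0 r⁻¹) (ball 0 1) := by
    intro z hz
    rw [mem_ball_zero_iff] at hz ⊢
    rw [norm_mul, Complex.norm_of_nonneg hr0.le]
    calc r * ‖z‖ < r * r⁻¹ := by gcongr
      _ = 1 := mul_inv_cancel₀ hr0.ne'
  have hrinv : 1 < r⁻¹ := (one_lt_inv₀ hr0).mpr hr1
  have hd : ∀ i j, DifferentiableOn ℂ (fun z => F (r * z) i j) (ball 0 r⁻¹) := fun i j =>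
    (hF i j).comp (by fun_prop) hmaps
  have hd' : ∀ i j, DiffContOnCl ℂ (fun z => F (r * z) i j) (ball 0 1) := fun i j => by
    refine ((hd i j).mono ?_).diffContOnCl
    rw [closure_ball _ one_ne_zero]
    exact closedBall_subset_ball hrinv
  have hrc : (r : ℂ) ≠ 0 := by exact_mod_cast hr0.ne'
  obtain ⟨b, c, hb, hc, hbc, hn⟩ := isBalancedProduct_of_differentiableOn hrinv
    ((hd 0 1).mul (hd 1 0)) (z₀ := (r : ℂ)⁻¹ * z₀) (by
      rw [mem_ball_zero_iff] at hz₀ ⊢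
      rw [norm_mul, norm_inv, Complex.norm_of_nonneg hr0.le]
      exact mul_lt_of_lt_one_right (inv_pos.mpr hr0) hz₀)
    (by simpa [mul_inv_cancel_left₀ hrc] using hF₀)
  refine ⟨fun k => b (lam k), fun k => c (lam k), fun k => hbc _ (ball_subset_closedBall (hlam k)),
    posSemidef_pickMatrix (G := fun z => !![F (r * z) 0 0, b z; c z, F (r * z) 1 1]) hlam ?_ ?_⟩
  · intro i j
    fin_cases i <;> fin_cases j
    exacts [hd' 0 0, hb, hc, hd' 1 1]
  · intro z hz x y
    exact contraction_of_muDiag_le_one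
      (hmu _ (hmaps (closedBall_subset_ball hrinv (sphere_subset_closedBall hz))))
      (hbc z (sphere_subset_closedBall hz)) (hn z hz) x y

/-- Interpolation data of an analytic function with structured singular value at most one admit a
rebalancing of the off-diagonal entries with positive semidefinite Pick matrix. -/
theorem exists_posSemidef_pickMatrix_of_muDiag_le_one {ι : Type*} [Fintype ι] {lam : ι → ℂ}
    (hlam : ∀ k, lam k ∈ ball (0 : ℂ) 1) {F : ℂ → Matrix (Fin 2) (Fin 2) ℂ}
    (hF : ∀ i j, DifferentiableOn ℂ (fun z => F z i j) (ball 0 1))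
    (hmu : ∀ z ∈ ball (0 : ℂ) 1, muDiag (F z) ≤ 1) {z₀ : ℂ} (hz₀ : z₀ ∈ ball (0 : ℂ) 1)
    (hF₀ : F z₀ 0 1 * F z₀ 1 0 ≠ 0) :
    ∃ b c : ι → ℂ, (∀ k, b k * c k = F (lam k) 0 1 * F (lam k) 1 0) ∧
      (pickMatrix lam fun k => !![F (lam k) 0 0, b k; c k, F (lam k) 1 1]).PosSemidef := by
  obtain ⟨r, -, hr, hrt⟩ := exists_seq_strictMono_tendsto' (zero_lt_one (α := ℝ))
  choose b c hbc hP using fun m =>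
    exists_posSemidef_pickMatrix_dilation hlam hF hmu hz₀ hF₀ (hr m).1 (hr m).2
  have hmem : ∀ m, (b m, c m) ∈ closedBall (0 : (ι → ℂ) × (ι → ℂ)) 1 := by
    intro m
    rw [mem_closedBall_zero_iff, Prod.norm_mk, max_le_iff, pi_norm_le_iff_of_nonneg zero_le_one,
      pi_norm_le_iff_of_nonneg zero_le_one]
    exact ⟨fun k => norm_le_one_of_posSemidef_pickMatrix hlam (hP m) k 0 1,
      fun k => norm_le_one_of_posSemidef_pickMatrix hlam (hP m) k 1 0⟩
  obtain ⟨⟨b₀, c₀⟩, -, φ, hφ, hlim⟩ := (isCompact_closedBall _ _).tendsto_subseq hmem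
  have hb : ∀ k, Tendsto (fun m => b (φ m) k) atTop (𝓝 (b₀ k)) :=
    tendsto_pi_nhds.mp ((continuous_fst.tendsto _).comp hlim)
  have hc : ∀ k, Tendsto (fun m => c (φ m) k) atTop (𝓝 (c₀ k)) :=
    tendsto_pi_nhds.mp ((continuous_snd.tendsto _).comp hlim)
  have hFlim : ∀ k i j, Tendsto (fun m => F (r (φ m) * lam k) i j) atTop (𝓝 (F (lam k) i j)) := by
    intro k i j
    have h1 : ContinuousAt (fun z => F z i j) (lam k) :=
      (hF i j).continuousOn.continuousAt (isOpen_ball.mem_nhds (hlam k))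
    have h2 : Tendsto (fun m => (r (φ m) : ℂ) * lam k) atTop (𝓝 (lam k)) := by
      have h3 := (Complex.continuous_ofReal.tendsto 1).comp (hrt.comp hφ.tendsto_atTop)
      simpa using h3.mul_const (lam k)
    exact h1.tendsto.comp h2
  refine ⟨b₀, c₀, fun k => ?_, ?_⟩
  · refine tendsto_nhds_unique ((hb k).mul (hc k)) ?_
    simp only [hbc]
    exact (hFlim k 0 1).mul (hFlim k 1 0)
  · have hV : Tendsto (fun m k => !![F (r (φ m) * lam k) 0 0, b (φ m) k;
        c (φ m) k, F (r (φ m) * lam k) 1 1]) atTop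
        (𝓝 fun k => !![F (lam k) 0 0, b₀ k; c₀ k, F (lam k) 1 1]) := by
      refine tendsto_pi_nhds.mpr fun k =>
        tendsto_pi_nhds.mpr fun i => tendsto_pi_nhds.mpr fun j => ?_
      fin_cases i <;> fin_cases j
      exacts [hFlim k 0 0, hb k, hc k, hFlim k 1 1]
    exact isClosed_setOf_posSemidef.mem_of_tendsto (((continuous_pickMatrix lam).tendsto _).comp hV)
      (Eventually.of_forall fun m => hP (φ m))

/-- A positive semidefinite Pick matrix yields an analytic interpolant with structured singular
value at most one, whatever the distribution of the off-diagonal products. -/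
theorem exists_interpolant_muDiag_le_one {ι : Type*} [Fintype ι] [DecidableEq ι] {lam : ι → ℂ}
    (hlam : ∀ k, lam k ∈ ball (0 : ℂ) 1) (hinj : Function.Injective lam)
    {W : ι → Matrix (Fin 2) (Fin 2) ℂ} (hW : ∀ k, W k 0 1 * W k 1 0 ≠ 0) {b c : ι → ℂ}
    (hbc : ∀ k, b k * c k = W k 0 1 * W k 1 0)
    (hP : (pickMatrix lam fun k => !![W k 0 0, b k; c k, W k 1 1]).PosSemidef) :
    ∃ F : ℂ → Matrix (Fin 2) (Fin 2) ℂ,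
      (∀ i j, DifferentiableOn ℂ (fun z => F z i j) (ball 0 1)) ∧
      (∀ k, F (lam k) = W k) ∧ ∀ z ∈ ball (0 : ℂ) 1, muDiag (F z) ≤ 1 := by
  obtain ⟨G, hGd, hGn, hGi⟩ := exists_interpolant_of_posSemidef_pickMatrix hlam hP
  let q := Lagrange.interpolate Finset.univ lam fun k => Complex.log (W k 0 1 / b k)
  have hb0 : ∀ k, b k ≠ 0 := fun k h => hW k (by rw [← hbc, h, zero_mul])
  have hexp : ∀ k, Complex.exp (q.eval (lam k)) = W k 0 1 / b k := fun k => by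
    rw [Lagrange.eval_interpolate_at_node _ hinj.injOn (Finset.mem_univ k), Complex.exp_log]
    exact div_ne_zero (left_ne_zero_of_mul (hW k)) (hb0 k)
  refine ⟨fun z => !![G z 0 0, G z 0 1 * Complex.exp (q.eval z);
    G z 1 0 * Complex.exp (-q.eval z), G z 1 1], fun i j => ?_, fun k => ?_, fun z hz => ?_⟩
  · have hq : DifferentiableOn ℂ (fun z => q.eval z) (ball 0 1) := q.differentiable.differentiableOn
    fin_cases i <;> fin_cases j
    exacts [hGd 0 0, (hGd 0 1).mul hq.cexp, (hGd 1 0).mul hq.neg.cexp, hGd 1 1]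
  · have h01 := left_ne_zero_of_mul (hW k)
    have hbk := hb0 k
    have hk := hbc k
    simp only [hGi, Complex.exp_neg, hexp]
    ext i j
    fin_cases i <;> fin_cases j
    · simp
    · simp [mul_div_cancel₀ _ hbk]
    · simp only [Fin.mk_one, Fin.zero_eta, Matrix.of_apply, Matrix.cons_val', Matrix.cons_val_zero,
        Matrix.cons_val_one, Matrix.cons_val_fin_one, inv_div]
      field_simp
      linear_combination hk
    · simp
  · refine muDiag_le_one_of_opNorm2_le_one (hGn z hz) rfl rfl ?_
    have := Complex.exp_ne_zero (q.eval z)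
    simp only [Matrix.of_apply, Matrix.cons_val', Matrix.cons_val_zero, Matrix.cons_val_one,
      Matrix.cons_val_fin_one, Complex.exp_neg]
    field_simp

end DiagonalInterpolation

theorem stmt_5 (n : ℕ) (lam : Fin n → ℂ) (hlam : ∀ k, lam k ∈ Metric.ball (0:ℂ) 1)
    (hinj : Function.Injective lam) (W : Fin n → Matrix (Fin 2) (Fin 2) ℂ)
    (hW : ∀ k, W k 0 1 * W k 1 0 ≠ 0) :
    (∃ F : ℂ → Matrix (Fin 2) (Fin 2) ℂ,
        (∀ i j, DifferentiableOn ℂ (fun z => F z i j) (Metric.ball (0:ℂ) 1)) ∧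
        (∀ k, F (lam k) = W k) ∧
        ∀ z ∈ Metric.ball (0:ℂ) 1, muDiag (F z) ≤ 1) ↔
    (∃ b c : Fin n → ℂ,
        (∀ k, b k * c k = W k 0 0 * W k 1 1 - (W k).det) ∧
        (Matrix.of (fun p q : Fin n × Fin 2 =>
          ((1 - (!![W p.1 0 0, b p.1; c p.1, W p.1 1 1])ᴴ *
              !![W q.1 0 0, b q.1; c q.1, W q.1 1 1]) p.2 q.2) /
            (1 - (starRingEnd ℂ) (lam p.1) * lam q.1))).PosSemidef) := by
  have hdet : ∀ k, W k 0 0 * W k 1 1 - (W k).det = W k 0 1 * W k 1 0 := fun k => by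
    rw [Matrix.det_fin_two]; ring
  simp only [hdet]
  change _ ↔ ∃ b c : Fin n → ℂ, (∀ k, b k * c k = W k 0 1 * W k 1 0) ∧
    (pickMatrix lam fun k => !![W k 0 0, b k; c k, W k 1 1]).PosSemidef
  constructor
  · rintro ⟨F, hF, hFW, hmu⟩
    rcases n.eq_zero_or_pos with rfl | hn
    · refine ⟨fun _ => 0, fun _ => 0, fun k => k.elim0, ?_⟩
      exact .of_dotProduct_mulVec_nonneg (isHermitian_pickMatrix lam _) fun x => by
        simp [dotProduct]
    · obtain ⟨b, c, hbc, hP⟩ := exists_posSemidef_pickMatrix_of_muDiag_le_one hlam hF hmu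
        (hlam ⟨0, hn⟩) (by rw [hFW]; exact hW _)
      simp only [hFW] at hbc hP
      exact ⟨b, c, hbc, hP⟩
  · rintro ⟨b, c, hbc, hP⟩
    exact exists_interpolant_muDiag_le_one hlam hinj hW hbc hP
end

section
/- For x = (x₁,x₂,x₃) ∈ ℂ³, the following are equivalent: (1) x ∈ Ē; (2) there exists a 2×2 complex matrix A = [a_{ij}] with ‖A‖ ≤ 1 such that x = (a₁₁, a₂₂, det A). -/
/-- The closed tetrablock. -/
def closedTetra : Set (ℂ × ℂ × ℂ) :=
  {x | ∀ z ∈ Metric.ball (0:ℂ) 1, ∀ w ∈ Metric.ball (0:ℂ) 1,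
        1 - x.1 * z - x.2.1 * w + x.2.2 * z * w ≠ 0}

open ComplexConjugate in
/-- Nonvanishing on the bidisc gives `‖b - d z‖ ≤ ‖1 - a z‖` on the closed disc; the estimate is the
case of the unimodular `z` that aligns `(a - conj b * d) * z` with the positive real axis. -/
lemma norm_sub_conj_mul_le {a b d : ℂ}
    (h : ∀ z ∈ Metric.ball (0 : ℂ) 1, ∀ w ∈ Metric.ball (0 : ℂ) 1,
      1 - a * z - b * w + d * z * w ≠ 0) :
    ‖b‖ ^ 2 + ‖d‖ ^ 2 + 2 * ‖a - conj b * d‖ ≤ 1 + ‖a‖ ^ 2 := by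
  have hball : ∀ z ∈ Metric.ball (0 : ℂ) 1, ‖b - d * z‖ ≤ ‖1 - a * z‖ := by
    intro z hz
    by_contra! hlt
    have hpos : 0 < ‖b - d * z‖ := (norm_nonneg _).trans_lt hlt
    have hne : b - d * z ≠ 0 := norm_pos_iff.mp hpos
    refine h z hz ((1 - a * z) / (b - d * z)) ?_ ?_
    · rw [mem_ball_zero_iff, norm_div, div_lt_one hpos]
      exact hlt
    · linear_combination -(div_mul_cancel₀ (1 - a * z) hne)
  have hclosed : ∀ z : ℂ, ‖z‖ ≤ 1 → ‖b - d * z‖ ≤ ‖1 - a * z‖ := by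
    intro z hz
    have hz' : z ∈ closure (Metric.ball (0 : ℂ) 1) := by
      rw [closure_ball _ one_ne_zero]
      simpa using hz
    exact le_on_closure hball (by fun_prop) (by fun_prop) hz'
  obtain ⟨z, hz, hza⟩ : ∃ z : ℂ, ‖z‖ = 1 ∧ (a - conj b * d) * z = ‖a - conj b * d‖ := by
    by_cases hc : a - conj b * d = 0
    · exact ⟨1, by simp, by simp [hc]⟩
    · have hn : (‖a - conj b * d‖ : ℂ) ≠ 0 := by simpa using hc
      refine ⟨conj (a - conj b * d) / ‖a - conj b * d‖, ?_, ?_⟩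
      · rw [norm_div, RCLike.norm_conj, Complex.norm_real, norm_norm, div_self (by simpa using hc)]
      · rw [← mul_div_assoc, Complex.mul_conj', sq, mul_div_assoc, div_self hn, mul_one]
  have hsq := pow_le_pow_left₀ (norm_nonneg _) (hclosed z hz.le) 2
  have hre := congrArg Complex.re hza
  rw [Complex.ofReal_re] at hre
  rw [← hre]
  have hz2 : z.re * z.re + z.im * z.im = 1 := by
    rw [← Complex.normSq_apply, ← Complex.sq_norm, hz, one_pow]
  simp only [Complex.sq_norm, Complex.normSq_apply, Complex.sub_re, Complex.sub_im,
    Complex.mul_re, Complex.mul_im, Complex.one_re, Complex.one_im, Complex.conj_re,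
    Complex.conj_im] at hsq ⊢
  linear_combination hsq + (a.re ^ 2 + a.im ^ 2 - d.re ^ 2 - d.im ^ 2) * hz2

open ComplexConjugate in
lemma norm_sq_add_norm_sq_add_le {a b d : ℂ} (ha : ‖a‖ ≤ 1) (hb : ‖b‖ ≤ 1)
    (h : ‖b‖ ^ 2 + ‖d‖ ^ 2 + 2 * ‖a - conj b * d‖ ≤ 1 + ‖a‖ ^ 2) :
    ‖a‖ ^ 2 + ‖b‖ ^ 2 + 2 * ‖a * b - d‖ ≤ 1 + ‖d‖ ^ 2 := by
  have hid : ‖a * b - d‖ ^ 2 =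
      ‖a - conj b * d‖ ^ 2 - (1 - ‖b‖ ^ 2) * (‖a‖ ^ 2 - ‖d‖ ^ 2) := by
    simp only [Complex.sq_norm, Complex.normSq_apply, Complex.sub_re, Complex.sub_im,
      Complex.mul_re, Complex.mul_im, Complex.conj_re, Complex.conj_im]
    ring
  have htri : ‖a‖ - ‖b‖ * ‖d‖ ≤ ‖a - conj b * d‖ := by
    simpa using norm_sub_norm_le a (conj b * d)
  have habs : ‖b‖ - ‖d‖ ≤ 1 - ‖a‖ :=
    le_of_abs_le (abs_le_of_sq_le_sq (by nlinarith) (by linarith))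
  have hsum : ‖a‖ ^ 2 + ‖b‖ ^ 2 ≤ 1 + ‖d‖ ^ 2 := by
    have := norm_nonneg a
    have := norm_nonneg b
    rcases le_total (‖a‖ + ‖b‖) 1 with hab | hab
    · nlinarith [sq_nonneg ‖d‖]
    · nlinarith [mul_nonneg (sub_nonneg.mpr ha) (sub_nonneg.mpr hb)]
  have hsq : (2 * ‖a * b - d‖) ^ 2 ≤ (1 + ‖d‖ ^ 2 - ‖a‖ ^ 2 - ‖b‖ ^ 2) ^ 2 := by
    have := pow_le_pow_left₀ (by positivity)
      (show 2 * ‖a - conj b * d‖ ≤ 1 + ‖a‖ ^ 2 - ‖b‖ ^ 2 - ‖d‖ ^ 2 by linarith) 2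
    linear_combination this + 4 * hid
  linarith [le_of_abs_le (abs_le_of_sq_le_sq hsq (by linarith))]

lemma opNorm2_le_one_iff (A : Matrix (Fin 2) (Fin 2) ℂ) :
    opNorm2 A ≤ 1 ↔ ∀ u v : ℂ,
      ‖A 0 0 * u + A 0 1 * v‖ ^ 2 + ‖A 1 0 * u + A 1 1 * v‖ ^ 2 ≤ ‖u‖ ^ 2 + ‖v‖ ^ 2 := by
  have hsq : ∀ x : EuclideanSpace ℂ (Fin 2),
      ‖Matrix.toEuclideanCLM (𝕜 := ℂ) A x‖ ≤ 1 * ‖x‖ ↔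
        ‖A 0 0 * x 0 + A 0 1 * x 1‖ ^ 2 + ‖A 1 0 * x 0 + A 1 1 * x 1‖ ^ 2
          ≤ ‖x 0‖ ^ 2 + ‖x 1‖ ^ 2 := by
    intro x
    rw [one_mul, ← sq_le_sq₀ (norm_nonneg _) (norm_nonneg _), EuclideanSpace.norm_sq_eq,
      EuclideanSpace.norm_sq_eq]
    simp [Fin.sum_univ_two, Matrix.mulVec, dotProduct]
  rw [opNorm2, ContinuousLinearMap.opNorm_le_iff zero_le_one]
  simp only [hsq]
  exact ⟨fun h u v => by simpa using h !₂[u, v], fun h x => h _ _⟩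

lemma mem_closedTetra_of_opNorm2_le_one {A : Matrix (Fin 2) (Fin 2) ℂ} (hA : opNorm2 A ≤ 1) :
    (A 0 0, A 1 1, A.det) ∈ closedTetra := by
  intro z hz w hw h0
  rw [mem_ball_zero_iff] at hz hw
  have hdet : (1 - A * Matrix.diagonal ![z, w]).det = 0 := by
    rw [← h0]
    simp [Matrix.det_fin_two]
    ring
  obtain ⟨v, hv, hker⟩ := Matrix.exists_mulVec_eq_zero_iff.mpr hdet
  have h₀ := congrFun hker 0
  have h₁ := congrFun hker 1
  simp [Matrix.mulVec, dotProduct, Fin.sum_univ_two] at h₀ h₁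
  have hc := (opNorm2_le_one_iff A).mp hA (z * v 0) (w * v 1)
  rw [show A 0 0 * (z * v 0) + A 0 1 * (w * v 1) = v 0 by linear_combination -h₀,
    show A 1 0 * (z * v 0) + A 1 1 * (w * v 1) = v 1 by linear_combination -h₁,
    norm_mul, norm_mul, mul_pow, mul_pow] at hc
  have hz2 : ‖z‖ ^ 2 < 1 := by nlinarith [norm_nonneg z]
  have hw2 : ‖w‖ ^ 2 < 1 := by nlinarith [norm_nonneg w]
  have h0' : ‖v 0‖ ^ 2 = 0 := by nlinarith [sq_nonneg ‖v 0‖, sq_nonneg ‖v 1‖]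
  have h1' : ‖v 1‖ ^ 2 = 0 := by nlinarith [sq_nonneg ‖v 0‖, sq_nonneg ‖v 1‖]
  refine hv (funext fun i => ?_)
  fin_cases i
  · simpa using h0'
  · simpa using h1'

open ComplexConjugate in
lemma opNorm2_symm_le_one {a b s : ℂ} (hd : ‖a * b - s ^ 2‖ ≤ 1)
    (h : ‖a‖ ^ 2 + ‖b‖ ^ 2 + 2 * ‖s‖ ^ 2 ≤ 1 + ‖a * b - s ^ 2‖ ^ 2) :
    opNorm2 !![a, s; s, b] ≤ 1 := by
  rw [opNorm2_le_one_iff]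
  intro u v
  set P := 1 - ‖a‖ ^ 2 - ‖s‖ ^ 2 with hP
  set Q := 1 - ‖b‖ ^ 2 - ‖s‖ ^ 2 with hQ
  set c := conj a * s + conj s * b with hc
  have hdet : P * Q - ‖c‖ ^ 2 =
      1 - ‖a‖ ^ 2 - ‖b‖ ^ 2 - 2 * ‖s‖ ^ 2 + ‖a * b - s ^ 2‖ ^ 2 := by
    simp only [hP, hQ, hc, sq s, Complex.sq_norm, Complex.normSq_apply, Complex.sub_re,
      Complex.sub_im, Complex.add_re, Complex.add_im, Complex.mul_re, Complex.mul_im,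
      Complex.conj_re, Complex.conj_im]
    ring
  have hPQ : ‖c‖ ^ 2 ≤ P * Q := by linarith
  have hsum : 0 ≤ P + Q := by nlinarith [norm_nonneg (a * b - s ^ 2)]
  have hP0 : 0 ≤ P := by nlinarith [sq_nonneg ‖c‖, sq_nonneg P]
  have hQ0 : 0 ≤ Q := by nlinarith [sq_nonneg ‖c‖, sq_nonneg Q]
  have hexp : ‖u‖ ^ 2 + ‖v‖ ^ 2 - (‖a * u + s * v‖ ^ 2 + ‖s * u + b * v‖ ^ 2) =
      P * ‖u‖ ^ 2 + Q * ‖v‖ ^ 2 - 2 * (c * conj u * v).re := by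
    simp only [hP, hQ, hc, Complex.sq_norm, Complex.normSq_apply, Complex.add_re,
      Complex.add_im, Complex.mul_re, Complex.mul_im, Complex.conj_re, Complex.conj_im]
    ring
  have hre : (c * conj u * v).re ≤ ‖c‖ * ‖u‖ * ‖v‖ := by
    simpa using Complex.re_le_norm (c * conj u * v)
  have hcs : 2 * (‖c‖ * ‖u‖ * ‖v‖) ≤ P * ‖u‖ ^ 2 + Q * ‖v‖ ^ 2 := by
    refine le_of_abs_le (abs_le_of_sq_le_sq ?_ (by positivity))
    nlinarith [mul_le_mul_of_nonneg_right hPQ (sq_nonneg (‖u‖ * ‖v‖)),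
      sq_nonneg (P * ‖u‖ ^ 2 - Q * ‖v‖ ^ 2)]
  simp
  linarith


theorem stmt_8 (x₁ x₂ x₃ : ℂ) :
    (x₁, x₂, x₃) ∈ closedTetra ↔
      ∃ A : Matrix (Fin 2) (Fin 2) ℂ, opNorm2 A ≤ 1 ∧
        x₁ = A 0 0 ∧ x₂ = A 1 1 ∧ x₃ = A.det := by
  constructor
  · intro h
    have h₁ := norm_sub_conj_mul_le h
    have h₂ := norm_sub_conj_mul_le (a := x₂) (b := x₁) (d := x₃) fun z hz w hw h0 =>
      h w hw z hz (by linear_combination h0)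
    have hd : ‖x₃‖ ≤ 1 := by
      nlinarith [norm_nonneg (x₁ - starRingEnd ℂ x₂ * x₃),
        norm_nonneg (x₂ - starRingEnd ℂ x₁ * x₃)]
    have hle : ∀ {y : ℂ}, (∀ z ∈ Metric.ball (0 : ℂ) 1, 1 - y * z ≠ 0) → ‖y‖ ≤ 1 := by
      intro y hy
      by_contra! hlt
      have hy0 : y ≠ 0 := norm_pos_iff.mp (one_pos.trans hlt)
      refine hy y⁻¹ ?_ (by simp [hy0])
      rw [mem_ball_zero_iff, norm_inv]
      exact inv_lt_one_of_one_lt₀ hlt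
    have ha : ‖x₁‖ ≤ 1 := hle fun z hz => by simpa using h z hz 0 (by simp)
    have hb : ‖x₂‖ ≤ 1 := hle fun w hw => by simpa using h 0 (by simp) w hw
    obtain ⟨s, hs⟩ := IsAlgClosed.exists_pow_nat_eq (x₁ * x₂ - x₃) two_pos
    have hx₃ : x₁ * x₂ - s ^ 2 = x₃ := by rw [hs]; ring
    have key := norm_sq_add_norm_sq_add_le ha hb h₁
    rw [← hs, norm_pow] at key
    refine ⟨!![x₁, s; s, x₂], opNorm2_symm_le_one (by rwa [hx₃]) (by rwa [hx₃]), by simp,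
      by simp, ?_⟩
    rw [Matrix.det_fin_two_of, ← hx₃, sq]
  · rintro ⟨A, hA, rfl, rfl, rfl⟩
    exact mem_closedTetra_of_opNorm2_le_one hA
end

section
/- Let x = (x₁,x₂,x₃) : 𝔻 → ℂ³ be an analytic map with x(𝔻) ⊆ Ē. Then there exists an analytic function F = [F_{ij}] : 𝔻 → ℂ^{2×2} with ‖F(λ)‖ ≤ 1 for all λ ∈ 𝔻 such that x₁ = F₁₁, x₂ = F₂₂ and x₃ = det F on 𝔻. -/
open Metric Filter Topology

lemma closedTetra_swap {a b c : ℂ} (h : (a, b, c) ∈ closedTetra) : (b, a, c) ∈ closedTetra := by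
  intro z hz w hw h0
  refine h w hw z hz ?_
  linear_combination h0

lemma closedTetra_norm_sub_mul_le {a b c z : ℂ} (h : (a, b, c) ∈ closedTetra) (hz : ‖z‖ ≤ 1) :
    ‖b - c * z‖ ≤ ‖1 - a * z‖ := by
  have key : ∀ z ∈ ball (0 : ℂ) 1, ‖b - c * z‖ ≤ ‖1 - a * z‖ := by
    intro z hz
    by_contra! hlt
    have hne : b - c * z ≠ 0 := norm_pos_iff.mp ((norm_nonneg _).trans_lt hlt)
    refine h z hz ((1 - a * z) / (b - c * z)) ?_ ?_
    · rw [mem_ball_zero_iff, norm_div]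
      exact (div_lt_one (norm_pos_iff.mpr hne)).mpr hlt
    · have hcancel := div_mul_cancel₀ (1 - a * z) hne
      linear_combination -hcancel
  have hz' : z ∈ closure (ball (0 : ℂ) 1) := by
    rw [closure_ball _ one_ne_zero]
    simpa using hz
  exact le_on_closure key (by fun_prop) (by fun_prop) hz'

lemma closedTetra_norm_fst_le_one {a b c : ℂ} (h : (a, b, c) ∈ closedTetra) : ‖a‖ ≤ 1 := by
  by_contra! hlt
  have ha : a ≠ 0 := norm_pos_iff.mp (one_pos.trans hlt)
  refine h a⁻¹ ?_ 0 (by simp) ?_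
  · rw [mem_ball_zero_iff, norm_inv]
    exact inv_lt_one_of_one_lt₀ hlt
  · simp [ha]

lemma closedTetra_two_mul_norm_le {a b c : ℂ} (h : (a, b, c) ∈ closedTetra) :
    2 * ‖a - star b * c‖ ≤ 1 + ‖a‖ ^ 2 - ‖b‖ ^ 2 - ‖c‖ ^ 2 := by
  obtain ⟨z, hz, hz'⟩ := RCLike.exists_norm_eq_mul_self (a - star b * c)
  have h1 := closedTetra_norm_sub_mul_le h hz.le
  have h2 : ‖b - c * z‖ ^ 2 ≤ ‖1 - a * z‖ ^ 2 := by gcongr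
  have hre : ‖a - star b * c‖ = (z * (a - star b * c)).re := by
    rw [← hz']
    rfl
  have hz2 : ‖z‖ ^ 2 = 1 := by simp [hz]
  simp only [Complex.sq_norm, Complex.normSq_apply, Complex.sub_re, Complex.sub_im, Complex.mul_re,
    Complex.mul_im, Complex.one_re, Complex.one_im, Complex.star_def, Complex.conj_re,
    Complex.conj_im] at *
  have e1 : (c.re * c.re + c.im * c.im) * (z.re * z.re + z.im * z.im)
    = c.re * c.re + c.im * c.im := by rw [hz2, mul_one]
  have e2 : (a.re * a.re + a.im * a.im) * (z.re * z.re + z.im * z.im)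
    = a.re * a.re + a.im * a.im := by rw [hz2, mul_one]
  linarith

lemma sq_add_sq_le_of_add_le {x y t : ℝ} (ht : 0 ≤ t) (hx : 0 ≤ x) (hy : 0 ≤ y) (hx1 : x ≤ 1)
    (hy1 : y ≤ 1) (h : x + y ≤ 1 + t) : x ^ 2 + y ^ 2 ≤ 1 + t ^ 2 := by
  by_cases hxy : x + y ≤ 1
  · nlinarith
  · nlinarith [mul_nonneg (sub_nonneg.mpr hx1) (sub_nonneg.mpr hy1)]

lemma closedTetra_two_mul_norm_det_le {a b c : ℂ} (h : (a, b, c) ∈ closedTetra) :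
    2 * ‖a * b - c‖ ≤ 1 + ‖c‖ ^ 2 - ‖a‖ ^ 2 - ‖b‖ ^ 2 := by
  have ha := closedTetra_norm_fst_le_one h
  have hb := closedTetra_norm_fst_le_one (closedTetra_swap h)
  have h1 := closedTetra_two_mul_norm_le h
  have h2 := closedTetra_two_mul_norm_le (closedTetra_swap h)
  have hc : ‖c‖ ^ 2 ≤ 1 := by linarith [norm_nonneg (a - star b * c), norm_nonneg (b - star a * c)]
  have hid : (1 + ‖a‖ ^ 2 - ‖b‖ ^ 2 - ‖c‖ ^ 2) ^ 2 - 4 * ‖a - star b * c‖ ^ 2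
      = (1 + ‖c‖ ^ 2 - ‖a‖ ^ 2 - ‖b‖ ^ 2) ^ 2 - 4 * ‖a * b - c‖ ^ 2 := by
    simp only [Complex.sq_norm, Complex.normSq_apply, Complex.sub_re, Complex.sub_im,
      Complex.mul_re, Complex.mul_im, Complex.star_def, Complex.conj_re, Complex.conj_im]
    ring
  have hpos : 0 ≤ 1 + ‖c‖ ^ 2 - ‖a‖ ^ 2 - ‖b‖ ^ 2 := by
    have t1 : ‖a‖ - ‖b‖ * ‖c‖ ≤ ‖a - star b * c‖ := by
      simpa using norm_sub_norm_le a (star b * c)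
    have t2 : (‖b‖ - ‖c‖) ^ 2 ≤ (1 - ‖a‖) ^ 2 := by linarith
    have t3 := (abs_le_of_sq_le_sq' t2 (by linarith)).2
    have := sq_add_sq_le_of_add_le (norm_nonneg c) (norm_nonneg a) (norm_nonneg b) ha hb
      (by linarith)
    linarith
  refine abs_le_of_sq_le_sq' ?_ hpos |>.2
  have : (2 * ‖a - star b * c‖) ^ 2 ≤ (1 + ‖a‖ ^ 2 - ‖b‖ ^ 2 - ‖c‖ ^ 2) ^ 2 := by gcongr
  linarith

lemma opNorm2_le {a b c d : ℂ} {M : ℝ} (hM : 0 ≤ M)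
    (h : ∀ p q : ℂ, ‖a * p + b * q‖ ^ 2 + ‖c * p + d * q‖ ^ 2 ≤ M ^ 2 * (‖p‖ ^ 2 + ‖q‖ ^ 2)) :
    opNorm2 !![a, b; c, d] ≤ M := by
  refine ContinuousLinearMap.opNorm_le_bound _ hM fun v => ?_
  refine abs_le_of_sq_le_sq' ?_ (by positivity) |>.2
  rw [mul_pow, EuclideanSpace.norm_sq_eq, EuclideanSpace.norm_sq_eq]
  simpa [Matrix.ofLp_toEuclideanCLM, Matrix.mulVec, dotProduct, Fin.sum_univ_two] using
    h (v 0) (v 1)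

lemma norm_entry_le_opNorm2 (A : Matrix (Fin 2) (Fin 2) ℂ) (i j : Fin 2) :
    ‖A i j‖ ≤ opNorm2 A := by
  have h1 := (Matrix.toEuclideanCLM (𝕜 := ℂ) A).le_opNorm (EuclideanSpace.single j 1)
  have h2 := PiLp.norm_apply_le (Matrix.toEuclideanCLM (𝕜 := ℂ) A (EuclideanSpace.single j 1)) i
  simp [Matrix.ofLp_toEuclideanCLM] at h1 h2
  exact h2.trans h1

lemma re_mul_le_of_norm_sq_le {P Q : ℝ} {R p q : ℂ} (hP : 0 ≤ P) (hQ : 0 ≤ Q)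
    (hR : ‖R‖ ^ 2 ≤ P * Q) : 2 * (R * star p * q).re ≤ P * ‖p‖ ^ 2 + Q * ‖q‖ ^ 2 := by
  have h1 : (R * star p * q).re ≤ ‖R‖ * ‖p‖ * ‖q‖ := by
    simpa using Complex.re_le_norm (R * star p * q)
  have h2 : ‖R‖ ≤ √P * √Q := by
    rw [← Real.sqrt_mul hP]
    exact Real.le_sqrt_of_sq_le hR
  have h3 : ‖R‖ * ‖p‖ * ‖q‖ ≤ √P * √Q * ‖p‖ * ‖q‖ := by gcongr
  have h4 := sq_nonneg (√P * ‖p‖ - √Q * ‖q‖)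
  have h5 := Real.sq_sqrt hP
  have h6 := Real.sq_sqrt hQ
  have h7 : (√P * ‖p‖ - √Q * ‖q‖) ^ 2
    = √P ^ 2 * ‖p‖ ^ 2 + √Q ^ 2 * ‖q‖ ^ 2 - 2 * (√P * √Q * ‖p‖ * ‖q‖) := by ring
  rw [h5, h6] at h7
  linarith

lemma opNorm2_le_one_of_closedTetra {a d b c : ℂ} (h : (a, d, a * d - b * c) ∈ closedTetra)
    (hbc : ‖b‖ = ‖c‖) : opNorm2 !![a, b; c, d] ≤ 1 := by
  have hdet := closedTetra_two_mul_norm_det_le h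
  have hn : ‖a * d - (a * d - b * c)‖ = ‖b‖ ^ 2 := by
    rw [sub_sub_cancel, norm_mul, ← hbc, sq]
  rw [hn] at hdet
  have hc : ‖a * d - b * c‖ ^ 2 ≤ 1 := by
    linarith [closedTetra_two_mul_norm_le h, closedTetra_two_mul_norm_le (closedTetra_swap h),
      norm_nonneg (a - star d * (a * d - b * c)), norm_nonneg (d - star a * (a * d - b * c))]
  have hR : ‖star a * b + star c * d‖ ^ 2 ≤ (1 - ‖a‖ ^ 2 - ‖c‖ ^ 2) * (1 - ‖d‖ ^ 2 - ‖b‖ ^ 2) := by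
    have hid : (1 - ‖a‖ ^ 2 - ‖c‖ ^ 2) * (1 - ‖d‖ ^ 2 - ‖b‖ ^ 2) - ‖star a * b + star c * d‖ ^ 2
        = 1 + ‖a * d - b * c‖ ^ 2 - ‖a‖ ^ 2 - ‖d‖ ^ 2 - ‖b‖ ^ 2 - ‖c‖ ^ 2 := by
      simp only [Complex.sq_norm, Complex.normSq_apply, Complex.sub_re, Complex.sub_im,
        Complex.mul_re, Complex.mul_im, Complex.star_def, Complex.conj_re, Complex.conj_im,
        Complex.add_re, Complex.add_im]
      ring
    rw [← hbc] at hid ⊢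
    linarith
  have hPQ := (sq_nonneg _).trans hR
  have hsum : 0 ≤ (1 - ‖a‖ ^ 2 - ‖c‖ ^ 2) + (1 - ‖d‖ ^ 2 - ‖b‖ ^ 2) := by
    rw [← hbc]
    linarith
  have hP : 0 ≤ 1 - ‖a‖ ^ 2 - ‖c‖ ^ 2 := by
    by_contra! hneg
    nlinarith
  have hQ : 0 ≤ 1 - ‖d‖ ^ 2 - ‖b‖ ^ 2 := by
    by_contra! hneg
    nlinarith
  refine opNorm2_le zero_le_one fun p q => ?_
  have hform := re_mul_le_of_norm_sq_le (p := p) (q := q) hP hQ hR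
  simp only [Complex.sq_norm, Complex.normSq_apply, Complex.mul_re, Complex.mul_im, Complex.star_def, Complex.conj_re, Complex.conj_im,
    Complex.add_re, Complex.add_im] at hform ⊢
  linarith

lemma opNorm2_add_le (A B : Matrix (Fin 2) (Fin 2) ℂ) :
    opNorm2 (A + B) ≤ opNorm2 A + opNorm2 B := by
  simpa [opNorm2] using 
    norm_add_le (Matrix.toEuclideanCLM (𝕜 := ℂ) A) (Matrix.toEuclideanCLM (𝕜 := ℂ) B)

lemma exists_sq_eq_norm_sub_sq_le (t g : ℂ) : ∃ s : ℂ, s ^ 2 = g ∧ ‖s - t‖ ^ 2 ≤ ‖g - t ^ 2‖ := by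
  obtain ⟨s, hs⟩ := IsAlgClosed.exists_pow_nat_eq g two_pos
  have hfac : ‖g - t ^ 2‖ = ‖s - t‖ * ‖s + t‖ := by
    rw [← norm_mul, ← hs]
    ring_nf
  rcases le_total ‖s - t‖ ‖s + t‖ with h | h
  · refine ⟨s, hs, ?_⟩
    rw [hfac, sq]
    gcongr
  · refine ⟨-s, by simpa using hs, ?_⟩
    have : ‖-s - t‖ = ‖s + t‖ := by rw [← norm_neg]; ring_nf
    rw [hfac, this, sq]
    gcongr

lemma exists_balanced_factors_near {b c g : ℂ} (hbc : ‖b‖ = ‖c‖) :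
    ∃ b' c' : ℂ, b' * c' = g ∧ ‖b'‖ = ‖c'‖ ∧ ‖b - b'‖ ^ 2 ≤ ‖g - b * c‖ ∧
      ‖c - c'‖ ^ 2 ≤ ‖g - b * c‖ := by
  obtain ⟨t, ht⟩ := IsAlgClosed.exists_pow_nat_eq (b * c) two_pos
  obtain ⟨w, hw, hb, hc⟩ : ∃ w : ℂ, ‖w‖ = 1 ∧ b = t * w ∧ c = t * w⁻¹ := by
    by_cases hb : b = 0
    · have hc : c = 0 := by simpa [hb] using hbc.symm
      have ht0 : t = 0 := by simpa [hb] using ht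
      exact ⟨1, by simp, by simp [hb, ht0], by simp [hc, ht0]⟩
    · have hc : c ≠ 0 := norm_ne_zero_iff.mp (hbc ▸ norm_ne_zero_iff.mpr hb)
      have ht0 : t ≠ 0 := by
        rintro rfl
        simp [hb, hc] at ht
      have hnt : ‖t‖ = ‖b‖ := by
        have := congrArg norm ht
        rw [norm_pow, norm_mul, ← hbc, ← sq] at this
        exact (pow_left_inj₀ (norm_nonneg _) (norm_nonneg _) two_ne_zero).mp this
      refine ⟨b / t, ?_, by field_simp, ?_⟩
      · rw [norm_div, hnt, div_self (norm_ne_zero_iff.mpr hb)]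
      · field_simp
        linear_combination -ht
  have hw0 : w ≠ 0 := norm_ne_zero_iff.mp (by simp [hw])
  obtain ⟨s, hs, hst⟩ := exists_sq_eq_norm_sub_sq_le t g
  rw [ht] at hst
  refine ⟨s * w, s * w⁻¹, ?_, by simp [hw], ?_, ?_⟩
  · field_simp
    exact hs
  · rwa [hb, ← sub_mul, norm_mul, hw, mul_one, norm_sub_rev, ← hb]
  · rwa [hc, ← sub_mul, norm_mul, norm_inv, hw, inv_one, mul_one, norm_sub_rev, ← hc]

lemma opNorm2_le_one_add_of_closedTetra {a d e b c : ℂ} {ε : ℝ} (hε : 0 ≤ ε)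
    (h : (a, d, e) ∈ closedTetra) (hbc : ‖b‖ = ‖c‖) (hg : ‖a * d - e - b * c‖ ≤ ε ^ 2) :
    opNorm2 !![a, b; c, d] ≤ 1 + ε := by
  obtain ⟨b', c', hmul, hnorm, hb, hc⟩ := exists_balanced_factors_near (g := a * d - e) hbc
  have h1 : opNorm2 !![a, b'; c', d] ≤ 1 := by
    refine opNorm2_le_one_of_closedTetra ?_ hnorm
    rwa [hmul, sub_sub_cancel]
  have h2 : opNorm2 !![0, b - b'; c - c', 0] ≤ ε := by
    refine opNorm2_le hε fun p q => ?_
    simp only [zero_mul, zero_add, add_zero, norm_mul, mul_pow]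
    nlinarith [mul_le_mul_of_nonneg_right (hb.trans hg) (sq_nonneg ‖q‖),
      mul_le_mul_of_nonneg_right (hc.trans hg) (sq_nonneg ‖p‖)]
  have hsplit : !![a, b; c, d] = !![a, b'; c', d] + !![0, b - b'; c - c', 0] := by
    ext i j
    fin_cases i <;> fin_cases j <;> simp
  rw [hsplit]
  linarith [opNorm2_add_le !![a, b'; c', d] !![0, b - b'; c - c', 0]]

lemma tendsto_opNorm2 {ι : Type*} {l : Filter ι} {A : ι → Matrix (Fin 2) (Fin 2) ℂ}
    {B : Matrix (Fin 2) (Fin 2) ℂ} (h : ∀ i j, Tendsto (fun n => A n i j) l (𝓝 (B i j))) :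
    Tendsto (fun n => opNorm2 (A n)) l (𝓝 (opNorm2 B)) := by
  have hcont : Continuous (Matrix.toEuclideanCLM (n := Fin 2) (𝕜 := ℂ)) :=
    LinearMap.continuous_of_finiteDimensional
      (Matrix.toEuclideanCLM (n := Fin 2) (𝕜 := ℂ)).toAlgEquiv.toLinearMap
  exact ((hcont.tendsto B).comp (tendsto_pi_nhds.mpr fun i => tendsto_pi_nhds.mpr (h i))).norm

lemma opNorm2_le_of_sphere {A : ℂ → Matrix (Fin 2) (Fin 2) ℂ} {M : ℝ}
    (hA : ∀ i j, DiffContOnCl ℂ (fun z => A z i j) (ball 0 1))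
    (hM : ∀ z ∈ sphere (0 : ℂ) 1, opNorm2 (A z) ≤ M) {z : ℂ} (hz : z ∈ ball (0 : ℂ) 1) :
    opNorm2 (A z) ≤ M := by
  have hsum : ∀ z, Matrix.toEuclideanCLM (𝕜 := ℂ) (A z) =
      ∑ i, ∑ j, A z i j • Matrix.toEuclideanCLM (𝕜 := ℂ) (Matrix.single i j (1 : ℂ)) := by
    intro z
    conv_lhs => rw [Matrix.matrix_eq_sum_single (A z)]
    simp only [map_sum, ← map_smul, Matrix.smul_single, smul_eq_mul, mul_one]
  have hd : DiffContOnCl ℂ (fun z => Matrix.toEuclideanCLM (𝕜 := ℂ) (A z)) (ball 0 1) := by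
    simp only [hsum, Fin.sum_univ_two]
    exact (((hA 0 0).smul_const _).add ((hA 0 1).smul_const _)).add
      (((hA 1 0).smul_const _).add ((hA 1 1).smul_const _))
  refine Complex.norm_le_of_forall_mem_frontier_norm_le isBounded_ball hd ?_ (subset_closure hz)
  rwa [frontier_ball _ one_ne_zero]

lemma exists_sq_eq_of_re_pos_or_eq_zero {f : ℂ → ℂ} (hf : Differentiable ℂ f)
    (hpos : ∀ z ∈ ball (0 : ℂ) 1, 0 < (f z).re)
    (hpos' : ∀ z ∈ closedBall (0 : ℂ) 1, 0 < (f z).re ∨ f z = 0) :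
    ∃ s : ℂ → ℂ, DiffContOnCl ℂ s (ball 0 1) ∧ ∀ z, s z ^ 2 = f z := by
  refine ⟨fun z => f z ^ (1 / 2 : ℂ), DiffContOnCl.mk_ball ?_ ?_, fun z => ?_⟩
  · intro z hz
    exact ((hf z).cpow_const (Or.inl (hpos z hz))).differentiableWithinAt
  · intro z hz
    refine ContinuousAt.continuousWithinAt ?_
    rcases hpos' z hz with h | h
    · exact hf.continuous.continuousAt.cpow continuousAt_const (Or.inl h)
    · have h0 := Complex.continuousAt_cpow_zero_of_re_pos (z := 1 / 2) (by norm_num)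
      rw [← h] at h0
      exact h0.comp (f := fun z => (f z, (1 / 2 : ℂ)))
        (hf.continuous.continuousAt.prodMk continuousAt_const)
  · simp [← Complex.cpow_nat_mul]

/-- A function on the closed unit disc that factors as a product of two functions, holomorphic
inside and continuous up to the boundary, whose moduli agree on the unit circle. -/
def HasBalancedFactors (g : ℂ → ℂ) : Prop :=
  ∃ u v : ℂ → ℂ, DiffContOnCl ℂ u (ball 0 1) ∧ DiffContOnCl ℂ v (ball 0 1) ∧
    (∀ z ∈ closedBall (0 : ℂ) 1, u z * v z = g z) ∧ ∀ z ∈ sphere (0 : ℂ) 1, ‖u z‖ = ‖v z‖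

namespace HasBalancedFactors

lemma mul {f g : ℂ → ℂ} (hf : HasBalancedFactors f) (hg : HasBalancedFactors g) :
    HasBalancedFactors fun z => f z * g z := by
  obtain ⟨u, v, hu, hv, huv, hn⟩ := hf
  obtain ⟨u', v', hu', hv', huv', hn'⟩ := hg
  refine ⟨fun z => u z * u' z, fun z => v z * v' z, hu.smul hu', hv.smul hv', fun z hz => ?_,
    fun z hz => ?_⟩
  · simp only [← huv z hz, ← huv' z hz, mul_mul_mul_comm]
  · rw [norm_mul, norm_mul, hn z hz, hn' z hz]

lemma of_sq {f s : ℂ → ℂ} (hs : DiffContOnCl ℂ s (ball 0 1)) (h : ∀ z, s z ^ 2 = f z) :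
    HasBalancedFactors f :=
  ⟨s, s, hs, hs, fun z _ => by rw [← h z, sq], fun _ _ => rfl⟩

lemma const (c : ℂ) : HasBalancedFactors fun _ => c := by
  obtain ⟨s, hs⟩ := IsAlgClosed.exists_pow_nat_eq c two_pos
  exact of_sq (s := fun _ => s) diffContOnCl_const fun _ => hs

lemma sub_of_norm_lt_one {a : ℂ} (ha : ‖a‖ < 1) : HasBalancedFactors fun z => z - a := by
  have hpos : ∀ z ∈ closedBall (0 : ℂ) 1, 0 < (1 - star a * z).re := by
    intro z hz
    have h1 : (star a * z).re ≤ ‖a‖ * ‖z‖ := by simpa using Complex.re_le_norm (star a * z)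
    have h2 : ‖a‖ * ‖z‖ ≤ ‖a‖ := mul_le_of_le_one_right (norm_nonneg _) (by simpa using hz)
    rw [Complex.sub_re, Complex.one_re]
    linarith
  obtain ⟨s, hs, hsq⟩ := exists_sq_eq_of_re_pos_or_eq_zero (f := fun z => 1 - star a * z)
    (by fun_prop) (fun z hz => hpos z (ball_subset_closedBall hz)) fun z hz => Or.inl (hpos z hz)
  have hs0 : ∀ z ∈ closedBall (0 : ℂ) 1, s z ≠ 0 := by
    intro z hz h0
    have := hpos z hz
    rw [← hsq z, h0] at this
    simp at this
  have hd : DiffContOnCl ℂ (fun z : ℂ => z - a) (ball 0 1) :=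
    Differentiable.diffContOnCl (by fun_prop)
  refine ⟨fun z => (z - a) * (s z)⁻¹, s, hd.smul (hs.inv ?_), hs, fun z hz => ?_, fun z hz => ?_⟩
  · rwa [closure_ball _ one_ne_zero]
  · exact inv_mul_cancel_right₀ (hs0 z hz) _
  · have hz1 : ‖z‖ = 1 := by simpa using hz
    have hs1 := norm_ne_zero_iff.mpr (hs0 z (sphere_subset_closedBall hz))
    have hzz : z * star z = 1 := by
      rw [Complex.star_def, Complex.mul_conj, Complex.normSq_eq_norm_sq, hz1]
      simp
    have hrefl : ‖z - a‖ = ‖s z‖ ^ 2 := by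
      rw [← norm_pow, hsq]
      have : 1 - star a * z = z * star (z - a) := by
        rw [star_sub, mul_sub, hzz, mul_comm]
      rw [this, norm_mul, hz1, norm_star, one_mul]
    rw [norm_mul, norm_inv, hrefl]
    field_simp

lemma sub_of_one_le_norm {a : ℂ} (ha : 1 ≤ ‖a‖) : HasBalancedFactors fun z => z - a := by
  have ha0 : a ≠ 0 := norm_pos_iff.mp (one_pos.trans_le ha)
  have hdiv : ∀ z : ℂ, ‖z / a‖ ≤ ‖z‖ := fun z => by
    rw [norm_div]
    exact div_le_self (norm_nonneg z) ha
  have hpos : ∀ z ∈ ball (0 : ℂ) 1, 0 < (1 - z / a).re := by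
    intro z hz
    rw [Complex.sub_re, Complex.one_re, sub_pos]
    exact (Complex.re_le_norm _).trans_lt ((hdiv z).trans_lt (by simpa using hz))
  have hpos' : ∀ z ∈ closedBall (0 : ℂ) 1, 0 < (1 - z / a).re ∨ 1 - z / a = 0 := by
    intro z hz
    have hle : ‖z / a‖ ≤ 1 := (hdiv z).trans (by simpa using hz)
    generalize z / a = w at hle
    rw [Complex.sub_re, Complex.one_re, sub_pos]
    rcases ((Complex.re_le_norm w).trans hle).lt_or_eq with h | h
    · exact Or.inl h
    · right
      have h2 : ‖w‖ ^ 2 ≤ 1 := pow_le_one₀ (norm_nonneg _) hle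
      rw [Complex.sq_norm, Complex.normSq_apply, h] at h2
      have him : w.im = 0 := by nlinarith
      apply Complex.ext <;> simp [h, him]
  obtain ⟨s, hs, hsq⟩ := exists_sq_eq_of_re_pos_or_eq_zero (by fun_prop) hpos hpos'
  have := (const (-a)).mul (of_sq hs hsq)
  convert this using 2 with z
  field_simp
  ring

lemma polynomial (p : Polynomial ℂ) : HasBalancedFactors fun z => p.eval z := by
  simp only [(IsAlgClosed.splits p).eval_eq_prod_roots]
  refine (const _).mul ?_
  induction p.roots using Multiset.induction_on with
  | empty => simpa using const 1
  | cons a m ih =>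
    simp only [Multiset.map_cons, Multiset.prod_cons]
    refine HasBalancedFactors.mul ?_ ih
    rcases lt_or_ge ‖a‖ 1 with ha | ha
    · exact sub_of_norm_lt_one ha
    · exact sub_of_one_le_norm ha

end HasBalancedFactors

lemma exists_polynomial_near_of_differentiableOn {g : ℂ → ℂ} {R : NNReal} (hR : 1 < R)
    (hg : DifferentiableOn ℂ g (closedBall 0 R)) {ε : ℝ} (hε : 0 < ε) :
    ∃ p : Polynomial ℂ, ∀ z ∈ closedBall (0 : ℂ) 1, ‖g z - p.eval z‖ ≤ ε := by
  obtain ⟨r, hr1, hrR⟩ := exists_between hR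
  have hps := hg.hasFPowerSeriesOnBall (one_pos.trans hR)
  have hu := hps.tendstoUniformlyOn' (r' := r) (by exact_mod_cast hrR)
  rw [Metric.tendstoUniformlyOn_iff] at hu
  obtain ⟨n, hn⟩ := (hu ε hε).exists
  refine ⟨∑ k ∈ Finset.range n, Polynomial.monomial k ((cauchyPowerSeries g 0 R).coeff k),
    fun z hz => ?_⟩
  have hz' : z ∈ ball (0 : ℂ) r := closedBall_subset_ball (by exact_mod_cast hr1) hz
  refine le_trans (le_of_eq ?_) (hn z hz').le
  rw [dist_eq_norm, Polynomial.eval_finsetSum, FormalMultilinearSeries.partialSum]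
  simp only [sub_zero, FormalMultilinearSeries.apply_eq_pow_smul_coeff, Polynomial.eval_monomial,
    smul_eq_mul, mul_comm]

lemma exists_differentiableOn_tendsto_ultrafilter {ι : Type*} (l : Ultrafilter ι)
    {f : ι → ℂ → ℂ} {s : Set ℂ} {C : ℝ} (hs : IsOpen s)
    (hf : ∀ n, DifferentiableOn ℂ (f n) s) (hC : ∀ n, ∀ z ∈ s, ‖f n z‖ ≤ C) :
    ∃ g : ℂ → ℂ, DifferentiableOn ℂ g s ∧ ∀ z ∈ s, Tendsto (fun n => f n z) l (𝓝 (g z)) := by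
  have hlim : ∀ z, ∃ w : ℂ, z ∈ s → Tendsto (fun n => f n z) l (𝓝 w) := by
    intro z
    by_cases hz : z ∈ s
    · obtain ⟨w, -, hw⟩ := (isCompact_closedBall (0 : ℂ) C).ultrafilter_le_nhds
        (l.map (f · z)) (by
          rw [le_principal_iff, Ultrafilter.coe_map, mem_map]
          exact univ_mem' fun n => by simpa using hC n z hz)
      exact ⟨w, fun _ => hw⟩
    · exact ⟨0, fun h => absurd h hz⟩
  choose g hg using hlim
  refine ⟨g, ?_, hg⟩
  refine TendstoLocallyUniformlyOn.differentiableOn (F := f) (φ := (l : Filter ι)) ?_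
    (Eventually.of_forall hf) hs
  rw [Metric.tendstoLocallyUniformlyOn_iff]
  intro ε hε x hx
  obtain ⟨R, hR, hRs⟩ := Metric.isOpen_iff.mp hs x hx
  have hlip : ∀ n, ∀ y ∈ ball x R, dist (f n y) (f n x) ≤ 2 * C / R * dist y x := by
    intro n y hy
    refine Complex.dist_le_div_mul_dist_of_mapsTo_ball ((hf n).mono hRs) (fun w hw => ?_) hy
    rw [mem_closedBall, dist_eq_norm]
    linarith [norm_sub_le (f n w) (f n x), hC n w (hRs hw), hC n x hx]
  have hlip' : ∀ y ∈ ball x R, dist (g y) (g x) ≤ 2 * C / R * dist y x := fun y hy =>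
    le_of_tendsto ((hg y (hRs hy)).dist (hg x hx)) (Eventually.of_forall fun n => hlip n y hy)
  have hsmall : ∀ᶠ y in 𝓝 x, 2 * C / R * dist y x < ε / 3 := by
    have : Tendsto (fun y => 2 * C / R * dist y x) (𝓝 x) (𝓝 (2 * C / R * dist x x)) :=
      Continuous.tendsto (by fun_prop) x
    exact this.eventually_lt_const (by rw [dist_self, mul_zero]; positivity)
  refine ⟨{y | 2 * C / R * dist y x < ε / 3} ∩ ball x R,
    mem_nhdsWithin_of_mem_nhds (inter_mem hsmall (ball_mem_nhds x hR)), ?_⟩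
  filter_upwards [Metric.tendsto_nhds.mp (hg x hx) (ε / 3) (by positivity)] with n hn y hy
  have h1 := hlip n y hy.2
  have h2 := hlip' y hy.2
  have h3 : 2 * C / R * dist y x < ε / 3 := hy.1
  have h4 := dist_triangle4 (g y) (g x) (f n x) (f n y)
  rw [dist_comm (g x), dist_comm (f n x) (f n y)] at h4
  linarith

lemma exists_approx_tetrablock_lift {a d e : ℂ → ℂ} {R : NNReal} (hR : 1 < R)
    (ha : DifferentiableOn ℂ a (closedBall 0 R)) (hd : DifferentiableOn ℂ d (closedBall 0 R))
    (he : DifferentiableOn ℂ e (closedBall 0 R))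
    (hE : ∀ z ∈ closedBall (0 : ℂ) 1, (a z, d z, e z) ∈ closedTetra) {ε : ℝ} (hε : 0 < ε) :
    ∃ u v : ℂ → ℂ, DifferentiableOn ℂ u (ball 0 1) ∧ DifferentiableOn ℂ v (ball 0 1) ∧
      ∀ z ∈ ball (0 : ℂ) 1, ‖a z * d z - e z - u z * v z‖ ≤ ε ^ 2 ∧
        opNorm2 !![a z, u z; v z, d z] ≤ 1 + ε := by
  obtain ⟨p, hp⟩ := exists_polynomial_near_of_differentiableOn hR ((ha.mul hd).sub he)
    (pow_pos hε 2)
  obtain ⟨u, v, hu, hv, huv, hn⟩ := HasBalancedFactors.polynomial p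
  have hsub : closure (ball (0 : ℂ) 1) ⊆ closedBall 0 R := by
    rw [closure_ball _ one_ne_zero]
    exact closedBall_subset_closedBall (by exact_mod_cast hR.le)
  have happ : ∀ z ∈ closedBall (0 : ℂ) 1, ‖a z * d z - e z - u z * v z‖ ≤ ε ^ 2 := by
    intro z hz
    rw [huv z hz]
    exact hp z hz
  refine ⟨u, v, hu.1, hv.1, fun z hz => ⟨happ z (ball_subset_closedBall hz), ?_⟩⟩
  refine opNorm2_le_of_sphere (A := fun z => !![a z, u z; v z, d z]) (fun i j => ?_)
    (fun w hw => ?_) hz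
  · have ha' := (ha.mono hsub).diffContOnCl
    have hd' := (hd.mono hsub).diffContOnCl
    fin_cases i <;> fin_cases j <;> simpa
  · exact opNorm2_le_one_add_of_closedTetra hε.le (hE w (sphere_subset_closedBall hw)) (hn w hw)
      (happ w (sphere_subset_closedBall hw))

theorem stmt_13 (x₁ x₂ x₃ : ℂ → ℂ)
    (hx : DifferentiableOn ℂ (fun z => ((x₁ z, x₂ z, x₃ z) : ℂ × ℂ × ℂ)) (Metric.ball (0:ℂ) 1))
    (hxE : ∀ z ∈ Metric.ball (0:ℂ) 1, (x₁ z, x₂ z, x₃ z) ∈ closedTetra) :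
    ∃ F : ℂ → Matrix (Fin 2) (Fin 2) ℂ,
      (∀ i j, DifferentiableOn ℂ (fun z => F z i j) (Metric.ball (0:ℂ) 1)) ∧
      (∀ z ∈ Metric.ball (0:ℂ) 1, opNorm2 (F z) ≤ 1) ∧
      ∀ z ∈ Metric.ball (0:ℂ) 1,
        x₁ z = F z 0 0 ∧ x₂ z = F z 1 1 ∧ x₃ z = (F z).det := by
  have h₁ : DifferentiableOn ℂ x₁ (ball 0 1) := hx.fst
  have h₂ : DifferentiableOn ℂ x₂ (ball 0 1) := hx.snd.fst
  have h₃ : DifferentiableOn ℂ x₃ (ball 0 1) := hx.snd.snd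
  let ε : ℕ → ℝ := fun n => 1 / ((n : ℝ) + 1)
  have hε : ∀ n, 0 < ε n := fun n => Nat.one_div_pos_of_nat
  have hε1 : ∀ n, ε n ≤ 1 := fun n => by
    simpa [ε] using Nat.one_div_le_one_div (α := ℝ) (Nat.zero_le n)
  have hε0 : Tendsto ε atTop (𝓝 0) := tendsto_one_div_add_atTop_nhds_zero_nat
  let R : ℕ → NNReal := fun n => 1 + ⟨ε n, (hε n).le⟩
  have hR : ∀ n, (R n : ℝ) = 1 + ε n := fun n => rfl
  let r : ℕ → ℂ := fun n => ((R n ^ 2 : ℝ) : ℂ)⁻¹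
  have hr : Tendsto r atTop (𝓝 1) := by
    have : Tendsto (fun n => (((1 + ε n) ^ 2 : ℝ) : ℂ)⁻¹) atTop (𝓝 (((1 + 0) ^ 2 : ℝ) : ℂ)⁻¹) :=
      ((Complex.continuous_ofReal.tendsto _).comp ((hε0.const_add 1).pow 2)).inv₀ (by simp)
    simpa [r, hR] using this
  have hscale : ∀ n, Set.MapsTo (fun z => r n * z) (closedBall 0 (R n)) (ball 0 1) := by
    intro n z hz
    have hpos : 0 < (R n : ℝ) := by rw [hR]; linarith [hε n]
    have h1 : 1 < (R n : ℝ) := by rw [hR]; linarith [hε n]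
    have hz' : ‖z‖ ≤ R n := by simpa using hz
    have hrn : ‖r n‖ = ((R n : ℝ) ^ 2)⁻¹ := by simp [r]
    rw [mem_ball_zero_iff, norm_mul, hrn, inv_mul_lt_one₀ (by positivity)]
    nlinarith
  have hR1 : ∀ n, 1 < R n := fun n => by
    rw [← NNReal.coe_lt_coe, hR, NNReal.coe_one]
    linarith [hε n]
  have hlift := fun n => exists_approx_tetrablock_lift (hR1 n)
    (h₁.comp (by fun_prop) (hscale n)) (h₂.comp (by fun_prop) (hscale n))
    (h₃.comp (by fun_prop) (hscale n)) (fun z hz => hxE _ (hscale n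
      (closedBall_subset_closedBall (by exact_mod_cast (hR1 n).le) hz))) (hε n)
  choose u v hu hv huv using hlift
  have hF2 := fun n z hz => (huv n z hz).2.trans (add_le_add_right (hε1 n) 1)
  let l := hyperfilter ℕ
  have hl : (l : Filter ℕ) ≤ atTop := Nat.hyperfilter_le_atTop
  obtain ⟨u', hu', hul⟩ := exists_differentiableOn_tendsto_ultrafilter l isOpen_ball hu
    fun n z hz => (norm_entry_le_opNorm2 _ 0 1).trans (hF2 n z hz)
  obtain ⟨v', hv', hvl⟩ := exists_differentiableOn_tendsto_ultrafilter l isOpen_ball hv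
    fun n z hz => (norm_entry_le_opNorm2 _ 1 0).trans (hF2 n z hz)
  have hxl : ∀ x : ℂ → ℂ, DifferentiableOn ℂ x (ball 0 1) → ∀ z ∈ ball (0 : ℂ) 1,
      Tendsto (fun n => x (r n * z)) l (𝓝 (x z)) := by
    intro x hx z hz
    have h := (hr.mul_const z).mono_left hl
    rw [one_mul] at h
    exact (hx.continuousOn.continuousAt (isOpen_ball.mem_nhds hz)).tendsto.comp h
  refine ⟨fun z => !![x₁ z, u' z; v' z, x₂ z], fun i j => ?_, fun z hz => ?_, fun z hz => ?_⟩
  · fin_cases i <;> fin_cases j <;> simpa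
  · have hlim : Tendsto (fun n => opNorm2 !![x₁ (r n * z), u n z; v n z, x₂ (r n * z)]) l
        (𝓝 (opNorm2 !![x₁ z, u' z; v' z, x₂ z])) := by
      refine tendsto_opNorm2 fun i j => ?_
      have t₁ := hxl x₁ h₁ z hz
      have t₂ := hxl x₂ h₂ z hz
      have tu := hul z hz
      have tv := hvl z hz
      fin_cases i <;> fin_cases j <;> simpa
    have hbound : Tendsto (fun n => 1 + ε n) l (𝓝 1) := by
      simpa using (hε0.const_add 1).mono_left hl
    exact le_of_tendsto_of_tendsto' hlim hbound fun n => (huv n z hz).2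
  · refine ⟨by simp, by simp, ?_⟩
    have hlim := (((hxl x₁ h₁ z hz).mul (hxl x₂ h₂ z hz)).sub (hxl x₃ h₃ z hz)).sub
      ((hul z hz).mul (hvl z hz))
    have hzero : Tendsto (fun n => ε n ^ 2) l (𝓝 0) := by
      simpa using (hε0.pow 2).mono_left hl
    have hlim0 := squeeze_zero_norm (fun n => (huv n z hz).1) hzero
    have heq := tendsto_nhds_unique hlim hlim0
    rw [Matrix.det_fin_two_of]
    linear_combination -heq
end

section
/- For a 2×2 complex matrix A = [a_{ij}], one has μ_Diag(A) < 1 if and only if (a₁₁, a₂₂, det A) ∈ E. -/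
/-- The open tetrablock. -/
def openTetra : Set (ℂ × ℂ × ℂ) :=
  {x | ∀ z ∈ Metric.closedBall (0:ℂ) 1, ∀ w ∈ Metric.closedBall (0:ℂ) 1,
        1 - x.1 * z - x.2.1 * w + x.2.2 * z * w ≠ 0}

lemma det_one_sub_mul_diagonal (A : Matrix (Fin 2) (Fin 2) ℂ) (v : Fin 2 → ℂ) :
    (1 - A * Matrix.diagonal v).det
      = 1 - A 0 0 * v 0 - A 1 1 * v 1 + A.det * v 0 * v 1 := by
  simp only [Matrix.det_fin_two, Matrix.sub_apply, Matrix.mul_diagonal, Matrix.one_apply]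
  simp
  ring

open scoped Matrix.Norms.L2Operator in
lemma opNorm2_diagonal (v : Fin 2 → ℂ) : opNorm2 (Matrix.diagonal v) = ‖v‖ := by
  rw [← Matrix.l2_opNorm_diagonal (𝕜 := ℂ) v, Matrix.cstar_norm_def]
  rfl

lemma mem_openTetra_iff (A : Matrix (Fin 2) (Fin 2) ℂ) :
    (A 0 0, A 1 1, A.det) ∈ openTetra ↔
      ∀ v : Fin 2 → ℂ, (1 - A * Matrix.diagonal v).det = 0 → 1 < ‖v‖ := by
  simp only [det_one_sub_mul_diagonal, openTetra, Set.mem_ofPred_eq, mem_closedBall_zero_iff]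
  constructor
  · intro h v hv
    by_contra! hle
    exact h (v 0) ((norm_le_pi_norm v 0).trans hle) (v 1) ((norm_le_pi_norm v 1).trans hle) hv
  · intro h z hz w hw h0
    refine (h ![z, w] (by simpa using h0)).not_ge ?_
    rw [pi_norm_le_iff_of_nonneg zero_le_one]
    simp [Fin.forall_fin_two, hz, hw]

lemma exists_isLeast_opNorm2 (A : Matrix (Fin 2) (Fin 2) ℂ)
    (h : ∃ v : Fin 2 → ℂ, (1 - A * Matrix.diagonal v).det = 0) :
    ∃ v : Fin 2 → ℂ, (1 - A * Matrix.diagonal v).det = 0 ∧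
      IsLeast {r : ℝ | ∃ X : Matrix (Fin 2) (Fin 2) ℂ,
        X.IsDiag ∧ (1 - A * X).det = 0 ∧ r = opNorm2 X} ‖v‖ := by
  have hclosed : IsClosed {v : Fin 2 → ℂ | (1 - A * Matrix.diagonal v).det = 0} := by
    simp only [det_one_sub_mul_diagonal]
    exact isClosed_eq (by fun_prop) continuous_const
  obtain ⟨v, hv, hdist⟩ := hclosed.exists_infDist_eq_dist h 0
  refine ⟨v, hv, ⟨Matrix.diagonal v, Matrix.isDiag_diagonal v, hv, (opNorm2_diagonal v).symm⟩, ?_⟩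
  rintro r ⟨X, hX, hdet, rfl⟩
  rw [← hX.diagonal_diag] at hdet ⊢
  rw [opNorm2_diagonal, ← dist_zero_left v, ← hdist, ← dist_zero_left]
  exact Metric.infDist_le_dist_of_mem hdet

theorem stmt_16 (A : Matrix (Fin 2) (Fin 2) ℂ) :
    muDiag A < 1 ↔ (A 0 0, A 1 1, A.det) ∈ openTetra := by
  rw [mem_openTetra_iff, muDiag]
  split_ifs with h
  · exact iff_of_true one_pos
      fun v hv => absurd hv (h _ (Matrix.isDiag_diagonal v))
  · push Not at h
    obtain ⟨X, hX, hdet⟩ := h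
    obtain ⟨v, hv, hleast⟩ :=
      exists_isLeast_opNorm2 A ⟨X.diag, by rwa [hX.diagonal_diag]⟩
    have hpos : 0 < ‖v‖ := by
      rw [norm_pos_iff]
      rintro rfl
      simp at hv
    rw [hleast.csInf_eq, inv_lt_one₀ hpos]
    exact ⟨fun h1 u hu => h1.trans_le
      (hleast.2 ⟨_, Matrix.isDiag_diagonal u, hu, (opNorm2_diagonal u).symm⟩),
      fun h1 => h1 v hv⟩
end
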